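/- arXiv:1412.1280 — 8 statements merged into one kernel-verified Lean document; each statement's English description precedes it below -/
import Mathlib

section
/- Let k ≥ 1 and let X_k be the k×k real matrix with ones on the sub- and super-diagonal and zeros elsewhere. Then for every n ≥ 0, the (1,1) entry of X_k^(2n) equals the number of non-crossing pair partitions of {1,…,2n} in which every pair has depth at most k−1. -/
/-- `X_k`: the `k × k` real matrix with ones on the sub- and super-diagonal. -/
def Xmat (k : ℕ) : Matrix (Fin k) (Fin k) ℝ :=
  Matrix.of fun i j => if (i : ℕ) + 1 = (j : ℕ) ∨ (j : ℕ) + 1 = (i : ℕ) then 1 else 0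

/-- `π` is a pair partition of `{1, …, m}`. -/
def IsPairPartition (m : ℕ) (π : Finset (Finset ℕ)) : Prop :=
  (∀ P ∈ π, P.card = 2) ∧
  (∀ i : ℕ, (∃ P ∈ π, i ∈ P) ↔ i ∈ Finset.Icc 1 m) ∧
  (∀ P ∈ π, ∀ Q ∈ π, P ≠ Q → Disjoint P Q)

/-- Non-crossing: there are no two pairs `{a,c}`, `{b,d}` with `a < b < c < d`. -/
def NonCrossing (π : Finset (Finset ℕ)) : Prop :=
  ∀ P ∈ π, ∀ Q ∈ π, P ≠ Q →
    ¬ ∃ a ∈ P, ∃ b ∈ Q, ∃ c ∈ P, ∃ d ∈ Q, a < b ∧ b < c ∧ c < d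

/-- `P` is nested inside `Q = {c, d}` (`c < d`) if `c < min P` and `max P < d`. -/
def Nested (P Q : Finset ℕ) : Prop :=
  ∃ c ∈ Q, ∃ d ∈ Q, ∀ x ∈ P, c < x ∧ x < d

/-- The depth of the pair `P` in `π`: the number of pairs `Q ∈ π` with `Q = P`
or `P` nested inside `Q`. -/
noncomputable def pairDepth (π : Finset (Finset ℕ)) (P : Finset ℕ) : ℕ :=
  Set.ncard {Q : Finset ℕ | Q ∈ π ∧ (Q = P ∨ Nested P Q)}

open Finset

namespace IsPairPartition

variable {m : ℕ} {π : Finset (Finset ℕ)}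

lemma eq_of_mem (hπ : IsPairPartition m π) {P Q : Finset ℕ} (hP : P ∈ π) (hQ : Q ∈ π) {x : ℕ}
    (hxP : x ∈ P) (hxQ : x ∈ Q) : P = Q := by
  by_contra h
  exact Finset.disjoint_left.mp (hπ.2.2 P hP Q hQ h) hxP hxQ

lemma mem_Icc (hπ : IsPairPartition m π) {P : Finset ℕ} (hP : P ∈ π) {x : ℕ} (hx : x ∈ P) :
    1 ≤ x ∧ x ≤ m :=
  Finset.mem_Icc.mp ((hπ.2.1 x).mp ⟨P, hP, hx⟩)

lemma exists_eq_pair (hπ : IsPairPartition m π) {P : Finset ℕ} (hP : P ∈ π) :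
    ∃ a b, a < b ∧ b < m ∧ P = {a + 1, b + 1} := by
  obtain ⟨x, y, hxy, rfl⟩ := Finset.card_eq_two.mp (hπ.1 P hP)
  have hx := hπ.mem_Icc hP (x := x) (by simp)
  have hy := hπ.mem_Icc hP (x := y) (by simp)
  rcases lt_or_gt_of_ne hxy with h | h
  · refine ⟨x - 1, y - 1, by omega, by omega, ?_⟩
    rw [Nat.sub_add_cancel hx.1, Nat.sub_add_cancel hy.1]
  · refine ⟨y - 1, x - 1, by omega, by omega, ?_⟩
    rw [Nat.sub_add_cancel hx.1, Nat.sub_add_cancel hy.1, Finset.pair_comm]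

lemma opener_or_closer (hπ : IsPairPartition m π) {i : ℕ} (hi : i < m) :
    (∃ b, i < b ∧ {i + 1, b + 1} ∈ π) ∨ ∃ a, a < i ∧ {a + 1, i + 1} ∈ π := by
  obtain ⟨P, hP, hiP⟩ := (hπ.2.1 (i + 1)).mpr (Finset.mem_Icc.mpr ⟨by omega, by omega⟩)
  obtain ⟨a, b, hab, -, rfl⟩ := hπ.exists_eq_pair hP
  simp only [Finset.mem_insert, Finset.mem_singleton, Nat.add_right_cancel_iff] at hiP
  rcases hiP with rfl | rfl
  · exact .inl ⟨b, hab, hP⟩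
  · exact .inr ⟨a, hab, hP⟩

lemma eq_of_subset {π' : Finset (Finset ℕ)} (hπ : IsPairPartition m π)
    (hπ' : IsPairPartition m π') (h : π ⊆ π') : π = π' := by
  refine h.antisymm fun Q hQ => ?_
  obtain ⟨a, b, -, -, rfl⟩ := hπ'.exists_eq_pair hQ
  obtain ⟨P, hP, haP⟩ := (hπ.2.1 (a + 1)).mpr ((hπ'.2.1 (a + 1)).mp ⟨_, hQ, by simp⟩)
  rwa [← hπ'.eq_of_mem (h hP) hQ haP (by simp)]

end IsPairPartition

/-- The pairs of `π` that separate `{…, i}` from `{i + 1, …}`. -/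
def cutPairs (π : Finset (Finset ℕ)) (i : ℕ) : Finset (Finset ℕ) :=
  π.filter fun Q => ∃ c ∈ Q, ∃ d ∈ Q, c ≤ i ∧ i < d

/-- The number of pairs of `π` that are open after position `i`. -/
def openCount (π : Finset (Finset ℕ)) (i : ℕ) : ℕ := #(cutPairs π i)

lemma mem_cutPairs {π : Finset (Finset ℕ)} {i : ℕ} {Q : Finset ℕ} :
    Q ∈ cutPairs π i ↔ Q ∈ π ∧ ∃ c ∈ Q, ∃ d ∈ Q, c ≤ i ∧ i < d := by
  simp [cutPairs]

section OpenCount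

variable {m : ℕ} {π : Finset (Finset ℕ)}

lemma openCount_zero (hπ : IsPairPartition m π) : openCount π 0 = 0 := by
  refine Finset.card_eq_zero.mpr (Finset.eq_empty_of_forall_notMem fun Q hQ => ?_)
  obtain ⟨hQ, c, hc, d, hd, h⟩ := mem_cutPairs.mp hQ
  have := hπ.mem_Icc hQ hc
  omega

lemma openCount_self (hπ : IsPairPartition m π) : openCount π m = 0 := by
  refine Finset.card_eq_zero.mpr (Finset.eq_empty_of_forall_notMem fun Q hQ => ?_)
  obtain ⟨hQ, c, hc, d, hd, h⟩ := mem_cutPairs.mp hQ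
  have := hπ.mem_Icc hQ hd
  omega

lemma openCount_opener (hπ : IsPairPartition m π) {a b : ℕ} (hab : a < b)
    (hP : {a + 1, b + 1} ∈ π) : openCount π (a + 1) = openCount π a + 1 := by
  have hn : {a + 1, b + 1} ∉ cutPairs π a := by
    simp only [mem_cutPairs, Finset.mem_insert, Finset.mem_singleton]
    rintro ⟨-, c, hc, d, hd, h⟩
    omega
  rw [openCount, openCount, ← Finset.card_insert_of_notMem hn]
  congr 1
  ext Q
  simp only [Finset.mem_insert, mem_cutPairs]
  constructor
  · rintro ⟨hQ, c, hc, d, hd, h⟩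
    refine or_iff_not_imp_left.mpr fun hne => ⟨hQ, c, hc, d, hd, ?_, by omega⟩
    have : c ≠ a + 1 := fun h' => hne (hπ.eq_of_mem hQ hP hc (by simp [h']))
    omega
  · rintro (rfl | ⟨hQ, c, hc, d, hd, h⟩)
    · exact ⟨hP, a + 1, by simp, b + 1, by simp, by omega, by omega⟩
    · refine ⟨hQ, c, hc, d, hd, by omega, ?_⟩
      have : d ≠ a + 1 := by
        rintro rfl
        obtain rfl := hπ.eq_of_mem hQ hP hd (by simp)
        simp only [Finset.mem_insert, Finset.mem_singleton] at hc
        omega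
      omega

lemma openCount_closer (hπ : IsPairPartition m π) {a b : ℕ} (hab : a < b)
    (hP : {a + 1, b + 1} ∈ π) : openCount π b = openCount π (b + 1) + 1 := by
  have hn : {a + 1, b + 1} ∉ cutPairs π (b + 1) := by
    simp only [mem_cutPairs, Finset.mem_insert, Finset.mem_singleton]
    rintro ⟨-, c, hc, d, hd, h⟩
    omega
  rw [openCount, openCount, ← Finset.card_insert_of_notMem hn]
  congr 1
  ext Q
  simp only [Finset.mem_insert, mem_cutPairs]
  constructor
  · rintro ⟨hQ, c, hc, d, hd, h⟩
    refine or_iff_not_imp_left.mpr fun hne => ⟨hQ, c, hc, d, hd, by omega, ?_⟩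
    have : d ≠ b + 1 := fun h' => hne (hπ.eq_of_mem hQ hP hd (by simp [h']))
    omega
  · rintro (rfl | ⟨hQ, c, hc, d, hd, h⟩)
    · exact ⟨hP, a + 1, by simp, b + 1, by simp, by omega, by omega⟩
    · refine ⟨hQ, c, hc, d, hd, ?_, by omega⟩
      have : c ≠ b + 1 := by
        rintro rfl
        obtain rfl := hπ.eq_of_mem hQ hP hc (by simp)
        simp only [Finset.mem_insert, Finset.mem_singleton] at hd
        omega
      omega

lemma openCount_step (hπ : IsPairPartition m π) {i : ℕ} (hi : i < m) :
    openCount π i + 1 = openCount π (i + 1) ∨ openCount π (i + 1) + 1 = openCount π i := by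
  rcases hπ.opener_or_closer hi with ⟨b, hb, hP⟩ | ⟨a, ha, hP⟩
  · exact .inl (openCount_opener hπ hb hP).symm
  · exact .inr (openCount_closer hπ ha hP).symm

lemma pairDepth_eq_openCount (hπ : IsPairPartition m π) (hN : NonCrossing π) {a b : ℕ}
    (hab : a < b) (hP : {a + 1, b + 1} ∈ π) :
    pairDepth π {a + 1, b + 1} = openCount π (a + 1) := by
  rw [pairDepth, openCount, ← Set.ncard_coe_finset]
  congr 1
  ext Q
  simp only [Set.mem_ofPred_eq, Finset.mem_coe, mem_cutPairs]
  refine and_congr_right fun hQ => ⟨?_, ?_⟩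
  · rintro (rfl | ⟨c, hc, d, hd, h⟩)
    · exact ⟨a + 1, by simp, b + 1, by simp, by omega, by omega⟩
    · have := h (a + 1) (by simp)
      exact ⟨c, hc, d, hd, by omega, by omega⟩
  · rintro ⟨c, hc, d, hd, h⟩
    refine or_iff_not_imp_left.mpr fun hne => ⟨c, hc, d, hd, ?_⟩
    have hca : c ≠ a + 1 := fun h' => hne (hπ.eq_of_mem hQ hP hc (by simp [h']))
    have hdb : d ≠ b + 1 := fun h' => hne (hπ.eq_of_mem hQ hP hd (by simp [h']))
    have hdb' : ¬ d < b + 1 := fun h' => hN Q hQ _ hP hne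
      ⟨c, hc, a + 1, by simp, d, hd, b + 1, by simp, by omega, by omega, h'⟩
    simp only [Finset.mem_insert, Finset.mem_singleton]
    omega

lemma forall_pairDepth_le_iff (hπ : IsPairPartition m π) (hN : NonCrossing π) (r : ℕ) :
    (∀ P ∈ π, pairDepth π P ≤ r) ↔ ∀ i ≤ m, openCount π i ≤ r := by
  constructor
  · intro h i hi
    induction i with
    | zero => simp [openCount_zero hπ]
    | succ i ih =>
      rcases hπ.opener_or_closer (i := i) (by omega) with ⟨b, hb, hP⟩ | ⟨a, ha, hP⟩
      · exact pairDepth_eq_openCount hπ hN hb hP ▸ h _ hP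
      · have := openCount_closer hπ ha hP
        have := ih (by omega)
        omega
  · intro h P hP
    obtain ⟨a, b, hab, hb, rfl⟩ := hπ.exists_eq_pair hP
    exact pairDepth_eq_openCount hπ hN hab hP ▸ h _ (by omega)

end OpenCount

/-- In the height profile `h`, the up-step from `a` to `a + 1` is matched with the down-step from
`b` to `b + 1`. -/
def IsArc (h : ℕ → ℕ) (a b : ℕ) : Prop :=
  a < b ∧ h a = h (b + 1) ∧ ∀ j, a < j → j ≤ b → h a < h j

open Classical in
/-- The set of pairs of matched steps of the height profile `h` on `{1, …, m}`. -/
noncomputable def stepMatching (m : ℕ) (h : ℕ → ℕ) : Finset (Finset ℕ) :=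
  ((range m ×ˢ range m).filter fun p => IsArc h p.1 p.2).image fun p => {p.1 + 1, p.2 + 1}

lemma mem_stepMatching {m : ℕ} {h : ℕ → ℕ} {P : Finset ℕ} :
    P ∈ stepMatching m h ↔ ∃ a b, IsArc h a b ∧ b < m ∧ P = {a + 1, b + 1} := by
  simp only [stepMatching, Finset.mem_image, Finset.mem_filter, Finset.mem_product,
    Finset.mem_range, Prod.exists]
  constructor
  · rintro ⟨a, b, ⟨⟨-, hb⟩, harc⟩, rfl⟩
    exact ⟨a, b, harc, hb, rfl⟩
  · rintro ⟨a, b, harc, hb, rfl⟩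
    exact ⟨a, b, ⟨⟨harc.1.trans hb, hb⟩, harc⟩, rfl⟩

/-- `h` is the height profile of a Dyck path with `m` steps. -/
def IsDyckProfile (m : ℕ) (h : ℕ → ℕ) : Prop :=
  h 0 = 0 ∧ h m = 0 ∧ ∀ i < m, h i + 1 = h (i + 1) ∨ h (i + 1) + 1 = h i

namespace IsArc

variable {h : ℕ → ℕ} {a b c d : ℕ}

lemma eq_of_left (h₁ : IsArc h a b) (h₂ : IsArc h a d) : b = d := by
  rcases lt_trichotomy b d with hlt | heq | hlt
  · have := h₂.2.2 (b + 1) (by have := h₁.1; omega) hlt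
    exact absurd h₁.2.1 this.ne
  · exact heq
  · have := h₁.2.2 (d + 1) (by have := h₂.1; omega) hlt
    exact absurd h₂.2.1 this.ne

lemma eq_of_right (h₁ : IsArc h a b) (h₂ : IsArc h c b) : a = c := by
  have e : h a = h c := h₁.2.1.trans h₂.2.1.symm
  rcases lt_trichotomy a c with hlt | heq | hlt
  · exact absurd e (h₁.2.2 c hlt h₂.1.le).ne
  · exact heq
  · exact absurd e.symm (h₂.2.2 a hlt h₁.1.le).ne

lemma not_left_right (h₁ : IsArc h a b) (h₂ : IsArc h c a) : False := by
  have e₁ := h₁.2.2 (a + 1) (by omega) h₁.1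
  have e₂ := h₂.2.2 a h₂.1 le_rfl
  have := h₂.2.1
  omega

lemma eq_of_common (h₁ : IsArc h a b) (h₂ : IsArc h c d) {x : ℕ} (hx₁ : x = a + 1 ∨ x = b + 1)
    (hx₂ : x = c + 1 ∨ x = d + 1) : a = c ∧ b = d := by
  rcases hx₁ with rfl | rfl <;> rcases hx₂ with hx | hx <;>
    obtain rfl := Nat.add_right_cancel hx
  · exact ⟨rfl, h₁.eq_of_left h₂⟩
  · exact (h₁.not_left_right h₂).elim
  · exact (h₂.not_left_right h₁).elim
  · exact ⟨h₁.eq_of_right h₂, rfl⟩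

lemma not_crossing (h₁ : IsArc h a b) (h₂ : IsArc h c d) (hac : a < c) (hcb : c < b)
    (hbd : b < d) : False := by
  have e₁ := h₁.2.2 c hac hcb.le
  have e₂ := h₂.2.2 (b + 1) (by omega) hbd
  have := h₁.2.1
  omega

end IsArc

namespace IsDyckProfile

variable {m : ℕ} {h : ℕ → ℕ}

lemma exists_isArc_of_up (hh : IsDyckProfile m h) {t : ℕ} (ht : t < m)
    (hup : h t + 1 = h (t + 1)) : ∃ b, b < m ∧ IsArc h t b := by
  classical
  have hm := hh.2.1
  have hne : m ≠ t + 1 := by rintro rfl; omega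
  have hex : ∃ b, t < b ∧ h (b + 1) ≤ h t := ⟨m - 1, by omega, by
    rw [Nat.sub_add_cancel (by omega)]; omega⟩
  obtain ⟨hb₁, hb₂⟩ := Nat.find_spec hex
  have hbm : Nat.find hex ≤ m - 1 := Nat.find_min' hex ⟨by omega, by
    rw [Nat.sub_add_cancel (by omega)]; omega⟩
  have hmin : ∀ j, t < j → j ≤ Nat.find hex → h t < h j := by
    intro j hj hjb
    by_cases hjt : j = t + 1
    · subst hjt; omega
    · have := Nat.find_min hex (m := j - 1) (by omega)
      rw [Nat.sub_add_cancel (by omega)] at this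
      by_contra h'
      exact this ⟨by omega, by omega⟩
  refine ⟨Nat.find hex, by omega, hb₁, ?_, hmin⟩
  have := hmin _ hb₁ le_rfl
  have := hh.2.2 (Nat.find hex) (by omega)
  omega

lemma exists_isArc_of_down (hh : IsDyckProfile m h) {t : ℕ} (ht : t < m)
    (hdown : h (t + 1) + 1 = h t) : ∃ a, IsArc h a t := by
  classical
  have h0 := hh.1
  have hspec := Nat.findGreatest_spec (P := fun a => h a ≤ h (t + 1)) (Nat.zero_le t)
    (by simp [h0])
  have hle := Nat.findGreatest_le (P := fun a => h a ≤ h (t + 1)) t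
  have hgr : ∀ j, _ → _ → ¬ h j ≤ h (t + 1) := fun j =>
    Nat.findGreatest_is_greatest (P := fun a => h a ≤ h (t + 1)) (n := t) (k := j)
  generalize Nat.findGreatest (fun a => h a ≤ h (t + 1)) t = a at *
  have hat : a ≠ t := by rintro rfl; omega
  have h₁ := hgr (a + 1) (by omega) (by omega)
  have h₂ := hh.2.2 a (by omega)
  have heq : h a = h (t + 1) := by omega
  refine ⟨a, by omega, heq, fun j hj hjt => ?_⟩
  have := hgr j hj hjt
  omega

lemma isPairPartition_stepMatching (hh : IsDyckProfile m h) :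
    IsPairPartition m (stepMatching m h) := by
  refine ⟨fun P hP => ?_, fun i => ⟨?_, fun hi => ?_⟩, fun P hP Q hQ hne => ?_⟩
  · obtain ⟨a, b, harc, -, rfl⟩ := mem_stepMatching.mp hP
    exact Finset.card_pair (by have := harc.1; omega)
  · rintro ⟨P, hP, hi⟩
    obtain ⟨a, b, harc, hb, rfl⟩ := mem_stepMatching.mp hP
    have := harc.1
    simp only [Finset.mem_insert, Finset.mem_singleton] at hi
    exact Finset.mem_Icc.mpr ⟨by omega, by omega⟩
  · obtain ⟨h1, h2⟩ := Finset.mem_Icc.mp hi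
    obtain ⟨t, rfl⟩ := Nat.exists_eq_add_of_le' h1
    rcases hh.2.2 t h2 with hs | hs
    · obtain ⟨b, hb, harc⟩ := hh.exists_isArc_of_up h2 hs
      exact ⟨_, mem_stepMatching.mpr ⟨t, b, harc, hb, rfl⟩, by simp⟩
    · obtain ⟨a, harc⟩ := hh.exists_isArc_of_down h2 hs
      exact ⟨_, mem_stepMatching.mpr ⟨a, t, harc, h2, rfl⟩, by simp⟩
  · obtain ⟨a, b, h₁, -, rfl⟩ := mem_stepMatching.mp hP
    obtain ⟨c, d, h₂, -, rfl⟩ := mem_stepMatching.mp hQ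
    refine Finset.disjoint_left.mpr fun x hx₁ hx₂ => hne ?_
    simp only [Finset.mem_insert, Finset.mem_singleton] at hx₁ hx₂
    obtain ⟨rfl, rfl⟩ := h₁.eq_of_common h₂ hx₁ hx₂
    rfl

lemma openCount_stepMatching (hh : IsDyckProfile m h) {i : ℕ} (hi : i ≤ m) :
    openCount (stepMatching m h) i = h i := by
  have hπ := hh.isPairPartition_stepMatching
  induction i with
  | zero => rw [openCount_zero hπ, hh.1]
  | succ i ih =>
    have ih := ih (by omega)
    rcases hh.2.2 i hi with hs | hs
    · obtain ⟨b, hb, harc⟩ := hh.exists_isArc_of_up hi hs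
      have := openCount_opener hπ harc.1 (mem_stepMatching.mpr ⟨i, b, harc, hb, rfl⟩)
      omega
    · obtain ⟨a, harc⟩ := hh.exists_isArc_of_down hi hs
      have := openCount_closer hπ harc.1 (mem_stepMatching.mpr ⟨a, i, harc, hi, rfl⟩)
      omega

end IsDyckProfile

lemma nonCrossing_stepMatching (m : ℕ) (h : ℕ → ℕ) : NonCrossing (stepMatching m h) := by
  rintro P hP Q hQ - ⟨x, hx, y, hy, z, hz, w, hw, hxy, hyz, hzw⟩
  obtain ⟨a, b, h₁, -, rfl⟩ := mem_stepMatching.mp hP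
  obtain ⟨c, d, h₂, -, rfl⟩ := mem_stepMatching.mp hQ
  simp only [Finset.mem_insert, Finset.mem_singleton] at hx hy hz hw
  have := h₁.1
  have := h₂.1
  exact h₁.not_crossing h₂ (by omega) (by omega) (by omega)

lemma stepMatching_congr {m : ℕ} {h h' : ℕ → ℕ} (heq : ∀ i ≤ m, h i = h' i) :
    stepMatching m h = stepMatching m h' := by
  ext P
  rw [mem_stepMatching, mem_stepMatching]
  refine exists_congr fun a => exists_congr fun b => ?_
  have key : ∀ {h h' : ℕ → ℕ}, (∀ i ≤ m, h i = h' i) → b < m → IsArc h a b → IsArc h' a b := by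
    intro h h' heq hb harc
    have := harc.1
    refine ⟨harc.1, ?_, fun j hj hjb => ?_⟩
    · rw [← heq a (by omega), ← heq (b + 1) hb, harc.2.1]
    · rw [← heq a (by omega), ← heq j (by omega)]
      exact harc.2.2 j hj hjb
  exact ⟨fun ⟨h₁, hb, hP⟩ => ⟨key heq hb h₁, hb, hP⟩,
    fun ⟨h₁, hb, hP⟩ => ⟨key (fun i hi => (heq i hi).symm) hb h₁, hb, hP⟩⟩

lemma isArc_openCount {m : ℕ} {π : Finset (Finset ℕ)} (hπ : IsPairPartition m π)
    (hN : NonCrossing π) {a b : ℕ} (hab : a < b) (hP : {a + 1, b + 1} ∈ π) :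
    IsArc (openCount π) a b := by
  have hout : ∀ Q ∈ cutPairs π a, Q ≠ {a + 1, b + 1} ∧ ∃ c ∈ Q, ∃ d ∈ Q, c ≤ a ∧ b + 1 < d := by
    intro Q hQ
    obtain ⟨hQ, c, hc, d, hd, h⟩ := mem_cutPairs.mp hQ
    have hne : Q ≠ {a + 1, b + 1} := by
      rintro rfl
      simp only [Finset.mem_insert, Finset.mem_singleton] at hc
      omega
    have hda : d ≠ a + 1 := fun h' => hne (hπ.eq_of_mem hQ hP hd (by simp [h']))
    have hdb : d ≠ b + 1 := fun h' => hne (hπ.eq_of_mem hQ hP hd (by simp [h']))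
    have hdb' : ¬ d < b + 1 := fun h' => hN Q hQ _ hP hne
      ⟨c, hc, a + 1, by simp, d, hd, b + 1, by simp, by omega, by omega, h'⟩
    exact ⟨hne, c, hc, d, hd, by omega, by omega⟩
  refine ⟨hab, ?_, fun j hj hjb => ?_⟩
  · rw [openCount, openCount]
    congr 1
    ext Q
    constructor
    · intro hQ
      obtain ⟨-, c, hc, d, hd, h⟩ := hout Q hQ
      exact mem_cutPairs.mpr ⟨(mem_cutPairs.mp hQ).1, c, hc, d, hd, by omega, by omega⟩
    · intro hQ
      obtain ⟨hQ, c, hc, d, hd, h⟩ := mem_cutPairs.mp hQ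
      have hne : Q ≠ {a + 1, b + 1} := by
        rintro rfl
        simp only [Finset.mem_insert, Finset.mem_singleton] at hd
        omega
      have hca : c ≠ a + 1 := fun h' => hne (hπ.eq_of_mem hQ hP hc (by simp [h']))
      have hcb : c ≠ b + 1 := fun h' => hne (hπ.eq_of_mem hQ hP hc (by simp [h']))
      have hca' : ¬ a + 1 < c := fun h' => hN _ hP Q hQ hne.symm
        ⟨a + 1, by simp, c, hc, b + 1, by simp, d, hd, h', by omega, by omega⟩
      exact mem_cutPairs.mpr ⟨hQ, c, hc, d, hd, by omega, by omega⟩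
  · refine Finset.card_lt_card ((Finset.ssubset_iff_of_subset fun Q hQ => ?_).mpr ?_)
    · obtain ⟨-, c, hc, d, hd, h⟩ := hout Q hQ
      exact mem_cutPairs.mpr ⟨(mem_cutPairs.mp hQ).1, c, hc, d, hd, by omega, by omega⟩
    · exact ⟨_, mem_cutPairs.mpr ⟨hP, a + 1, by simp, b + 1, by simp, by omega, by omega⟩,
        fun hQ => (hout _ hQ).1 rfl⟩

lemma isDyckProfile_openCount {m : ℕ} {π : Finset (Finset ℕ)} (hπ : IsPairPartition m π) :
    IsDyckProfile m (openCount π) :=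
  ⟨openCount_zero hπ, openCount_self hπ, fun _ hi => openCount_step hπ hi⟩

lemma stepMatching_openCount {m : ℕ} {π : Finset (Finset ℕ)} (hπ : IsPairPartition m π)
    (hN : NonCrossing π) : stepMatching m (openCount π) = π := by
  refine (hπ.eq_of_subset (isDyckProfile_openCount hπ).isPairPartition_stepMatching
    fun P hP => ?_).symm
  obtain ⟨a, b, hab, hb, rfl⟩ := hπ.exists_eq_pair hP
  exact mem_stepMatching.mpr ⟨a, b, isArc_openCount hπ hN hab hP, hb, rfl⟩

lemma SimpleGraph.exists_walk_getVert {V : Type*} (G : SimpleGraph V) (m : ℕ) (f : ℕ → V)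
    (hf : ∀ i < m, G.Adj (f i) (f (i + 1))) :
    ∃ p : G.Walk (f 0) (f m), p.length = m ∧ ∀ i ≤ m, p.getVert i = f i := by
  induction m generalizing f with
  | zero => exact ⟨.nil, rfl, fun i hi => by rw [Nat.le_zero.mp hi]; rfl⟩
  | succ m ih =>
    obtain ⟨p, hp, hv⟩ := ih (fun i => f (i + 1)) fun i hi => hf (i + 1) (by omega)
    refine ⟨.cons (hf 0 (by omega)) p, by simp [hp], fun i hi => ?_⟩
    cases i with
    | zero => rfl
    | succ i => exact hv i (by omega)

lemma Xmat_eq_adjMatrix (k : ℕ) [DecidableRel (SimpleGraph.pathGraph k).Adj] :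
    Xmat k = (SimpleGraph.pathGraph k).adjMatrix ℝ := by
  ext i j
  simp [Xmat, SimpleGraph.adjMatrix_apply, SimpleGraph.pathGraph_adj]

lemma isDyckProfile_getVert {k m : ℕ} (hk : 0 < k)
    (p : (SimpleGraph.pathGraph k).Walk ⟨0, hk⟩ ⟨0, hk⟩) (hp : p.length = m) :
    IsDyckProfile m fun i => (p.getVert i : ℕ) := by
  subst hp
  refine ⟨by simp, by simp, fun i hi => ?_⟩
  exact SimpleGraph.pathGraph_adj.mp (p.adj_getVert_succ hi)

theorem stmt0 (k : ℕ) (hk : 1 ≤ k) (n : ℕ) :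
    (Xmat k ^ (2 * n)) ⟨0, hk⟩ ⟨0, hk⟩ =
      (Set.ncard {π : Finset (Finset ℕ) |
        IsPairPartition (2 * n) π ∧ NonCrossing π ∧
        ∀ P ∈ π, pairDepth π P ≤ k - 1} : ℝ) := by
  classical
  rw [Xmat_eq_adjMatrix, SimpleGraph.adjMatrix_pow_apply_eq_card_walk, ← Nat.card_eq_fintype_card,
    Nat.card_coe_set_eq, Nat.cast_inj]
  refine Set.ncard_congr (fun p _ => stepMatching (2 * n) fun i => (p.getVert i : ℕ)) ?_ ?_ ?_
  · intro p hp
    have hh := isDyckProfile_getVert hk p hp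
    have hπ := hh.isPairPartition_stepMatching
    have hN := nonCrossing_stepMatching (2 * n) fun i => (p.getVert i : ℕ)
    refine ⟨hπ, hN, (forall_pairDepth_le_iff hπ hN _).mpr fun i hi => ?_⟩
    rw [hh.openCount_stepMatching hi]
    exact Nat.le_sub_one_of_lt (p.getVert i).isLt
  · intro p q hp hq heq
    refine SimpleGraph.Walk.ext_getVert_le_length (hp.trans hq.symm) fun i hi => Fin.ext ?_
    have hi' : i ≤ 2 * n := hi.trans_eq hp
    have h₁ := (isDyckProfile_getVert hk p hp).openCount_stepMatching hi'
    have h₂ := (isDyckProfile_getVert hk q hq).openCount_stepMatching hi'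
    rw [← h₁, ← h₂, heq]
  · rintro π ⟨hπ, hN, hd⟩
    have hlt : ∀ i ≤ 2 * n, openCount π i < k := fun i hi => by
      have := (forall_pairDepth_le_iff hπ hN _).mp hd i hi
      omega
    let f : ℕ → Fin k := fun i => if hi : i ≤ 2 * n then ⟨openCount π i, hlt i hi⟩ else ⟨0, hk⟩
    have hf : ∀ i ≤ 2 * n, (f i : ℕ) = openCount π i := fun i hi => by simp [f, hi]
    obtain ⟨p, hp, hv⟩ := (SimpleGraph.pathGraph k).exists_walk_getVert (2 * n) f fun i hi => by
      rw [SimpleGraph.pathGraph_adj, hf i hi.le, hf (i + 1) hi]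
      exact openCount_step hπ hi
    have h0 : f 0 = ⟨0, hk⟩ := Fin.ext ((hf 0 (by omega)).trans (openCount_zero hπ))
    have hm : f (2 * n) = ⟨0, hk⟩ := Fin.ext ((hf _ le_rfl).trans (openCount_self hπ))
    refine ⟨p.copy h0 hm, by simp [hp], ?_⟩
    rw [← stepMatching_openCount hπ hN]
    refine stepMatching_congr fun i hi => ?_
    rw [← hf i hi, ← hv i hi, SimpleGraph.Walk.getVert_copy]
end

section
/- Let k ≥ 1 and let X_k be the k×k real matrix with ones on the sub- and super-diagonal and zeros elsewhere. If n ≥ 0 and k ≥ n+1, then the (1,1) entry of X_k^(2n) equals the n-th Catalan number. -/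
theorem sum_mul_Xmat {k : ℕ} (f : Fin k → ℝ) (j : Fin k) :
    ∑ i, f i * Xmat k i j =
      (if h : 1 ≤ (j : ℕ) then f ⟨j - 1, by omega⟩ else 0) +
        (if h : (j : ℕ) + 1 < k then f ⟨j + 1, h⟩ else 0) := by
  have split_entry (i : Fin k) : f i * Xmat k i j =
      (if (i : ℕ) + 1 = j then f i else 0) + (if (j : ℕ) + 1 = i then f i else 0) := by
    simp only [Xmat, Matrix.of_apply]
    split_ifs <;> first | omega | simp
  simp only [split_entry, Finset.sum_add_distrib]
  congr 1
  · split_ifs with h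
    · rw [Finset.sum_eq_single ⟨j - 1, by omega⟩]
      · exact if_pos (by simp only; omega)
      · intro i _ hi
        exact if_neg fun hij => hi (Fin.ext (by simp only; omega))
      · simp
    · exact Finset.sum_eq_zero fun i _ => if_neg (by omega)
  · split_ifs with h
    · rw [Finset.sum_eq_single ⟨j + 1, h⟩]
      · simp
      · intro i _ hi
        exact if_neg fun hij => hi (Fin.ext hij.symm)
      · simp
    · exact Finset.sum_eq_zero fun i _ => if_neg (by omega)

/-- The ballot numbers: walks of length `m` from `0` to `j = 2 * s - m` reach height at most `s`,
so they are not affected by the truncation at `k`. -/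
theorem Xmat_pow_zero_apply {k : ℕ} (hk : 1 ≤ k) (m s : ℕ) (j : Fin k)
    (hj : m + (j : ℕ) = 2 * s) (hs : s < k) :
    (Xmat k ^ m) ⟨0, hk⟩ j = (m.choose s : ℝ) - (m.choose (s + 1) : ℝ) := by
  induction m generalizing s j with
  | zero =>
    rw [pow_zero, Matrix.one_apply]
    rcases s with _ | s
    · rw [if_pos (Fin.ext (by simp only; omega))]
      simp
    · rw [if_neg fun h => by have := congrArg Fin.val h; simp only at this; omega]
      simp
  | succ m ih =>
    obtain ⟨t, rfl⟩ : ∃ t, s = t + 1 := ⟨s - 1, by omega⟩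
    have lower : (if h : 1 ≤ (j : ℕ) then (Xmat k ^ m) ⟨0, hk⟩ ⟨j - 1, by omega⟩ else 0) =
        (m.choose t : ℝ) - (m.choose (t + 1) : ℝ) := by
      split_ifs with h
      · exact ih t _ (by simp only; omega) (by omega)
      · rw [Nat.choose_symm_of_eq_add (show m = t + (t + 1) by omega), sub_self]
    have upper : (if h : (j : ℕ) + 1 < k then (Xmat k ^ m) ⟨0, hk⟩ ⟨j + 1, h⟩ else 0) =
        (m.choose (t + 1) : ℝ) - (m.choose (t + 1 + 1) : ℝ) := by
      split_ifs with h
      · exact ih (t + 1) _ (by simp only; omega) hs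
      · rw [Nat.choose_eq_zero_of_lt (show m < t + 1 by omega),
          Nat.choose_eq_zero_of_lt (show m < t + 1 + 1 by omega), sub_self]
    rw [pow_succ, Matrix.mul_apply, sum_mul_Xmat, lower, upper, Nat.choose_succ_succ,
      Nat.choose_succ_succ m (t + 1)]
    push_cast
    ring

theorem stmt1 (k : ℕ) (hk : 1 ≤ k) (n : ℕ) (hkn : n + 1 ≤ k) :
    (Xmat k ^ (2 * n)) ⟨0, hk⟩ ⟨0, hk⟩ = (Nat.choose (2 * n) n : ℝ) / ((n : ℝ) + 1) := by
  rw [Xmat_pow_zero_apply hk (2 * n) n ⟨0, hk⟩ rfl hkn, eq_div_iff (by positivity)]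
  have h := Nat.choose_succ_right_eq (2 * n) n
  rw [show 2 * n - n = n by omega] at h
  have h' : ((2 * n).choose (n + 1) : ℝ) * (n + 1) = (2 * n).choose n * n := by exact_mod_cast h
  linarith
end

section
/- For every integer n ≥ 1, the identity 4^n − ∑_{k=1}^{n} (1/(2k−1))·binomial(2k,k)·4^(n−k) = binomial(2n,n) holds in the rational numbers. -/
theorem four_pow_sub_sum_centralBinom (n : ℕ) :
    (4 : ℚ) ^ n - ∑ k ∈ Finset.Icc 1 n,
        (1 / (2 * (k : ℚ) - 1)) * (Nat.centralBinom k : ℚ) * 4 ^ (n - k) =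
      (Nat.centralBinom n : ℚ) := by
  induction n with
  | zero => simp
  | succ n ih =>
    have hsum : ∑ k ∈ Finset.Icc 1 n,
        (1 / (2 * (k : ℚ) - 1)) * (Nat.centralBinom k : ℚ) * 4 ^ (n + 1 - k) =
        4 * ∑ k ∈ Finset.Icc 1 n,
          (1 / (2 * (k : ℚ) - 1)) * (Nat.centralBinom k : ℚ) * 4 ^ (n - k) := by
      rw [Finset.mul_sum]
      refine Finset.sum_congr rfl fun k hk => ?_
      rw [Nat.succ_sub (Finset.mem_Icc.mp hk).2, pow_succ]
      ring
    have hrec : ((n : ℚ) + 1) * (Nat.centralBinom (n + 1) : ℚ) =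
        2 * (2 * (n : ℚ) + 1) * (Nat.centralBinom n : ℚ) := by
      exact_mod_cast Nat.succ_mul_centralBinom_succ n
    have hpos : (2 * (n : ℚ) + 1) ≠ 0 := by positivity
    have hden : 2 * ((n + 1 : ℕ) : ℚ) - 1 = 2 * (n : ℚ) + 1 := by
      push_cast
      ring
    rw [Finset.sum_Icc_succ_top (by omega), hsum, hden, Nat.sub_self, pow_zero, pow_succ]
    have hlast : 1 / (2 * (n : ℚ) + 1) * (Nat.centralBinom (n + 1) : ℚ) =
        4 * (Nat.centralBinom n : ℚ) - (Nat.centralBinom (n + 1) : ℚ) := by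
      field_simp
      linear_combination 2 * hrec
    linear_combination 4 * ih - hlast

theorem stmt2 (n : ℕ) (hn : 1 ≤ n) :
    (4 : ℚ) ^ n - ∑ k ∈ Finset.Icc 1 n,
        (1 / (2 * (k : ℚ) - 1)) * (Nat.choose (2 * k) k : ℚ) * 4 ^ (n - k) =
      (Nat.choose (2 * n) n : ℚ) :=
  four_pow_sub_sum_centralBinom n
end

section
/- Let k ≥ 1 and let z be a complex number with nonzero imaginary part. Then U_k(z/2) ≠ 0 and ∑_{j=1}^{k} a_j^{(k)} / (z − x_j^{(k)}) = U_{k−1}(z/2) / U_k(z/2), where U_m denotes the degree-m Chebyshev polynomial of the second kind. -/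
/-- `x_j^{(k)} = 2 cos(jπ/(k+1))`. -/
noncomputable def xatom (k j : ℕ) : ℝ := 2 * Real.cos ((j : ℝ) * Real.pi / ((k : ℝ) + 1))

/-- `a_j^{(k)} = (1/(k+1))·(1 − cos(2jπ/(k+1)))`. -/
noncomputable def aatom (k j : ℕ) : ℝ :=
  (1 / ((k : ℝ) + 1)) * (1 - Real.cos (2 * (j : ℝ) * Real.pi / ((k : ℝ) + 1)))

open Polynomial Polynomial.Chebyshev

theorem angle_pos_lt_pi {k j : ℕ} (hj : j ∈ Finset.Icc 1 k) :
    0 < (j : ℝ) * Real.pi / ((k : ℝ) + 1) ∧ (j : ℝ) * Real.pi / ((k : ℝ) + 1) < Real.pi := by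
  obtain ⟨h1, h2⟩ := Finset.mem_Icc.mp hj
  have h1' : (0 : ℝ) < j := by exact_mod_cast h1
  have h2' : (j : ℝ) < k + 1 := by exact_mod_cast Nat.lt_succ_of_le h2
  refine ⟨by positivity, ?_⟩
  rw [div_lt_iff₀ (by positivity), mul_comm]
  exact mul_lt_mul_of_pos_left h2' Real.pi_pos

/-- The zeros of `U_k`, as complex numbers. -/
noncomputable def chebyshevUNode (k j : ℕ) : ℂ :=
  ((Real.cos ((j : ℝ) * Real.pi / ((k : ℝ) + 1)) : ℝ) : ℂ)

theorem xatom_eq_two_mul_node (k j : ℕ) : (xatom k j : ℂ) = 2 * chebyshevUNode k j := by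
  simp [xatom, chebyshevUNode]

theorem aatom_eq_node (k j : ℕ) :
    (aatom k j : ℂ) = 2 * ((1 - chebyshevUNode k j ^ 2) / ((k : ℂ) + 1)) := by
  have h : aatom k j =
      2 * ((1 - Real.cos ((j : ℝ) * Real.pi / ((k : ℝ) + 1)) ^ 2) / ((k : ℝ) + 1)) := by
    rw [aatom, show 2 * (j : ℝ) * Real.pi / ((k : ℝ) + 1) =
      2 * ((j : ℝ) * Real.pi / ((k : ℝ) + 1)) by ring, Real.cos_two_mul]
    ring
  rw [h, chebyshevUNode]
  push_cast
  rfl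

theorem injOn_chebyshevUNode (k : ℕ) :
    Set.InjOn (chebyshevUNode k) (Finset.Icc 1 k : Finset ℕ) := by
  intro i hi j hj hij
  have hi' := angle_pos_lt_pi hi
  have hj' := angle_pos_lt_pi hj
  have h := Real.injOn_cos ⟨hi'.1.le, hi'.2.le⟩ ⟨hj'.1.le, hj'.2.le⟩ (Complex.ofReal_injective hij)
  have hk : (k : ℝ) + 1 ≠ 0 := by positivity
  field_simp at h
  exact_mod_cast h

theorem eval_U_chebyshevUNode {k j : ℕ} (hj : j ∈ Finset.Icc 1 k) :
    (U ℂ (k : ℤ)).eval (chebyshevUNode k j) = 0 := by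
  have hθ := angle_pos_lt_pi hj
  have hs := Real.sin_pos_of_pos_of_lt_pi hθ.1 hθ.2
  have h := U_real_cos ((j : ℝ) * Real.pi / ((k : ℝ) + 1)) (k : ℤ)
  have hk : (k : ℝ) + 1 ≠ 0 := by positivity
  rw [Int.cast_natCast, mul_div_cancel₀ _ hk, Real.sin_nat_mul_pi] at h
  have h0 := (mul_eq_zero.mp h).resolve_right hs.ne'
  rw [chebyshevUNode, ← complex_ofReal_eval_U, h0, Complex.ofReal_zero]

theorem U_eq_C_mul_nodal (k : ℕ) :
    U ℂ (k : ℤ) = C (2 ^ k) * Lagrange.nodal (Finset.Icc 1 k) (chebyshevUNode k) := by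
  have h2 : (2 : ℂ) ^ k ≠ 0 := pow_ne_zero k two_ne_zero
  refine eq_of_degree_le_of_eval_index_eq (Finset.Icc 1 k) (injOn_chebyshevUNode k) ?_ ?_ ?_ ?_
  · simp
  · rw [degree_C_mul h2, Lagrange.degree_nodal]
    simp
  · rw [leadingCoeff_U_natCast, leadingCoeff_mul, leadingCoeff_C, Lagrange.nodal_monic, mul_one]
  · intro i hi
    rw [eval_U_chebyshevUNode hi, eval_mul, Lagrange.eval_nodal_at_node hi, mul_zero]

theorem one_sub_sq_mul_eval_derivative_U_of_eval_eq_zero {R : Type*} [CommRing R] {n : ℤ} {x : R}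
    (hx : (U R n).eval x = 0) :
    (1 - x ^ 2) * (derivative (U R n)).eval x = (n + 1) * (U R (n - 1)).eval x := by
  have h1 := congr_arg (eval x) (add_one_mul_T_eq_poly_in_U (R := R) n)
  have h2 := congr_arg (eval x) (U_eq_X_mul_U_add_T R n)
  have h3 := congr_arg (eval x) (U_add_one R n)
  simp [hx] at h1 h2 h3
  rw [h2] at h3
  rw [h3] at h1
  linear_combination h1

theorem two_pow_mul_nodalWeight_mul_eval_U {k j : ℕ} (hj : j ∈ Finset.Icc 1 k) :
    Lagrange.nodalWeight (Finset.Icc 1 k) (chebyshevUNode k) j *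
        (U ℂ ((k : ℤ) - 1)).eval (chebyshevUNode k j) =
      2 ^ k * ((1 - chebyshevUNode k j ^ 2) / ((k : ℂ) + 1)) := by
  have hw := Lagrange.nodalWeight_ne_zero (injOn_chebyshevUNode k) hj
  have h := one_sub_sq_mul_eval_derivative_U_of_eval_eq_zero (eval_U_chebyshevUNode hj)
  rw [U_eq_C_mul_nodal, derivative_C_mul, eval_mul, eval_C] at h
  rw [Lagrange.nodalWeight_eq_eval_derivative_nodal hj] at hw ⊢
  have hd := inv_ne_zero hw
  rw [inv_inv] at hd
  have hk : (k : ℂ) + 1 ≠ 0 := Nat.cast_add_one_ne_zero k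
  push_cast at h
  field_simp
  linear_combination -h

theorem eval_U_sub_one_eq_nodal_mul_sum {k : ℕ} (hk : 1 ≤ k) {w : ℂ}
    (hw : ∀ j ∈ Finset.Icc 1 k, w ≠ chebyshevUNode k j) :
    (U ℂ ((k : ℤ) - 1)).eval w = (U ℂ (k : ℤ)).eval w *
      ∑ j ∈ Finset.Icc 1 k, (1 - chebyshevUNode k j ^ 2) / ((k : ℂ) + 1) /
        (w - chebyshevUNode k j) := by
  have hdeg : (U ℂ ((k : ℤ) - 1)).degree < (Finset.Icc 1 k).card := by
    rw [← Nat.cast_pred hk, degree_U_natCast, Nat.card_Icc]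
    exact_mod_cast (by omega : k - 1 < k + 1 - 1)
  conv_lhs => rw [Lagrange.eq_interpolate (injOn_chebyshevUNode k) hdeg,
    Lagrange.eval_interpolate_not_at_node _ hw]
  rw [U_eq_C_mul_nodal, eval_mul, eval_C, mul_comm (2 ^ k : ℂ), mul_assoc,
    Finset.mul_sum _ _ (2 ^ k : ℂ)]
  congr 1
  refine Finset.sum_congr rfl fun j hj => ?_
  rw [mul_right_comm, two_pow_mul_nodalWeight_mul_eval_U hj]
  ring

theorem stmt4 (k : ℕ) (hk : 1 ≤ k) (z : ℂ) (hz : z.im ≠ 0) :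
    Polynomial.eval (z / 2) (Polynomial.Chebyshev.U ℂ (k : ℤ)) ≠ 0 ∧
    ∑ j ∈ Finset.Icc 1 k, (aatom k j : ℂ) / (z - (xatom k j : ℂ)) =
      Polynomial.eval (z / 2) (Polynomial.Chebyshev.U ℂ ((k : ℤ) - 1)) /
        Polynomial.eval (z / 2) (Polynomial.Chebyshev.U ℂ (k : ℤ)) := by
  have hw : ∀ j ∈ Finset.Icc 1 k, z / 2 ≠ chebyshevUNode k j := by
    intro j _ h
    apply hz
    rw [show z = 2 * (z / 2) by ring, h, ← xatom_eq_two_mul_node, Complex.ofReal_im]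
  have hU : (U ℂ (k : ℤ)).eval (z / 2) ≠ 0 := by
    rw [U_eq_C_mul_nodal, eval_mul, eval_C]
    exact mul_ne_zero (pow_ne_zero k two_ne_zero) (Lagrange.eval_nodal_not_at_node hw)
  refine ⟨hU, ?_⟩
  rw [eval_U_sub_one_eq_nodal_mul_sum hk hw, mul_div_cancel_left₀ _ hU]
  refine Finset.sum_congr rfl fun j _ => ?_
  rw [aatom_eq_node, xatom_eq_two_mul_node, show z - 2 * chebyshevUNode k j =
    2 * (z / 2 - chebyshevUNode k j) by ring, mul_div_mul_left _ _ two_ne_zero]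
end

section
/- For n ≥ 1 define G_n : ℂ → ℂ by G_n(z) = ∑_{j=1}^{n} a_j^{(n)} / (z − x_j^{(n)}). Then for every n ≥ 2 and every complex z with nonzero imaginary part, one has z − G_{n−1}(z) ≠ 0 and G_n(z) = 1 / (z − G_{n−1}(z)). -/
/-- `G_n(z) = ∑_{j=1}^n a_j^{(n)} / (z − x_j^{(n)})`, the Cauchy transform of `ν_n`. -/
noncomputable def Gtrans (n : ℕ) (z : ℂ) : ℂ :=
  ∑ j ∈ Finset.Icc 1 n, (aatom n j : ℂ) / (z - (xatom n j : ℂ))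

open Polynomial in
theorem Polynomial.Chebyshev.monic_S_and_natDegree_S (R : Type*) [CommRing R] [Nontrivial R] :
    ∀ n : ℕ, (Chebyshev.S R n).Monic ∧ (Chebyshev.S R n).natDegree = n
  | 0 => by simp
  | 1 => by simp [monic_X]
  | n + 2 => by
    obtain ⟨hm₀, hd₀⟩ := monic_S_and_natDegree_S R n
    obtain ⟨hm₁, hd₁⟩ := monic_S_and_natDegree_S R (n + 1)
    push_cast at hm₁ hd₁ ⊢
    rw [Chebyshev.S_add_two]
    have hm : (X * Chebyshev.S R (n + 1)).Monic := monic_X.mul hm₁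
    have hd : (X * Chebyshev.S R (n + 1)).natDegree = n + 2 := by
      rw [monic_X.natDegree_mul hm₁, natDegree_X, hd₁]
      ring
    have hlt : (Chebyshev.S R n).degree < (X * Chebyshev.S R (n + 1)).degree := by
      rw [degree_eq_natDegree hm₀.ne_zero, degree_eq_natDegree hm.ne_zero, hd₀, hd]
      exact_mod_cast (by lia : n < n + 2)
    exact ⟨hm.sub_of_left hlt, by
      rw [natDegree_sub_eq_left_of_natDegree_lt (by rw [hd₀, hd]; lia), hd]⟩

open Polynomial in
theorem Polynomial.Chebyshev.degree_S_natCast (R : Type*) [CommRing R] [Nontrivial R] (n : ℕ) :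
    (Chebyshev.S R n).degree = n := by
  obtain ⟨hm, hd⟩ := monic_S_and_natDegree_S R n
  rw [degree_eq_natDegree hm.ne_zero, hd]

open Polynomial in
theorem Polynomial.Chebyshev.derivative_S_two_mul_complex_cos (n : ℤ) (θ : ℂ) :
    (derivative (Chebyshev.S ℂ n)).eval (2 * Complex.cos θ) * (2 * -Complex.sin θ) * Complex.sin θ +
      (Chebyshev.S ℂ n).eval (2 * Complex.cos θ) * Complex.cos θ =
      Complex.cos ((n + 1) * θ) * (n + 1) := by
  have hl := (((Chebyshev.S ℂ n).hasDerivAt (2 * Complex.cos θ)).comp θ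
    ((Complex.hasDerivAt_cos θ).const_mul 2)).mul (Complex.hasDerivAt_sin θ)
  have hr := ((hasDerivAt_id θ).const_mul ((n : ℂ) + 1)).csin
  have heq : (fun t : ℂ ↦ Complex.sin (((n : ℂ) + 1) * id t)) =
      ((fun x ↦ (Chebyshev.S ℂ n).eval x) ∘ fun t ↦ 2 * Complex.cos t) * Complex.sin :=
    _root_.funext fun t ↦ (Chebyshev.S_two_mul_complex_cos t n).symm
  rw [heq] at hr
  simpa using hl.unique hr

/-- The angle `jπ/(n+1)`. -/
noncomputable def atomAngle (n j : ℕ) : ℝ := (j : ℝ) * Real.pi / ((n : ℝ) + 1)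

theorem atomAngle_mem_Ioo {n j : ℕ} (hj : j ∈ Finset.Icc 1 n) :
    atomAngle n j ∈ Set.Ioo 0 Real.pi := by
  obtain ⟨h1, h2⟩ := Finset.mem_Icc.mp hj
  have h1' : (1 : ℝ) ≤ j := by exact_mod_cast h1
  have h2' : (j : ℝ) ≤ n := by exact_mod_cast h2
  have hpi := Real.pi_pos
  unfold atomAngle
  refine ⟨by positivity, ?_⟩
  rw [div_lt_iff₀ (by positivity)]
  nlinarith

theorem sin_atomAngle_ne_zero {n j : ℕ} (hj : j ∈ Finset.Icc 1 n) :
    Complex.sin (atomAngle n j) ≠ 0 := by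
  exact_mod_cast (Real.sin_pos_of_mem_Ioo (atomAngle_mem_Ioo hj)).ne'

theorem add_one_mul_atomAngle (n j : ℕ) :
    ((n : ℂ) + 1) * (atomAngle n j : ℂ) = j * (Real.pi : ℂ) := by
  have : (n : ℂ) + 1 ≠ 0 := by exact_mod_cast n.succ_ne_zero
  unfold atomAngle
  push_cast
  field_simp

theorem sin_add_one_mul_atomAngle (n j : ℕ) :
    Complex.sin (((n : ℂ) + 1) * atomAngle n j) = 0 := by
  rw [add_one_mul_atomAngle, Complex.sin_nat_mul_pi]

theorem cos_add_one_mul_atomAngle_sq (n j : ℕ) :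
    Complex.cos (((n : ℂ) + 1) * atomAngle n j) ^ 2 = 1 := by
  rw [Complex.cos_sq', sin_add_one_mul_atomAngle]
  simp

theorem xatom_eq (n j : ℕ) : (xatom n j : ℂ) = 2 * Complex.cos (atomAngle n j) := by
  simp [xatom, atomAngle]

theorem aatom_eq (n j : ℕ) :
    (aatom n j : ℂ) = 2 * Complex.sin (atomAngle n j) ^ 2 / ((n : ℂ) + 1) := by
  have h : 2 * (j : ℝ) * Real.pi / ((n : ℝ) + 1) = 2 * atomAngle n j := by
    unfold atomAngle
    ring
  rw [aatom, h, Real.cos_two_mul, Real.cos_sq']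
  push_cast
  ring

theorem xatom_injOn (n : ℕ) :
    Set.InjOn (fun j ↦ (xatom n j : ℂ)) (Finset.Icc 1 n : Finset ℕ) := by
  intro i hi j hj hij
  have hx : xatom n i = xatom n j := Complex.ofReal_injective hij
  have hc : Real.cos (atomAngle n i) = Real.cos (atomAngle n j) := by
    unfold xatom at hx
    unfold atomAngle
    linarith
  have ha := Real.injOn_cos (Set.Ioo_subset_Icc_self (atomAngle_mem_Ioo hi))
    (Set.Ioo_subset_Icc_self (atomAngle_mem_Ioo hj)) hc
  have hpi := Real.pi_ne_zero
  have hn : (n : ℝ) + 1 ≠ 0 := by positivity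
  unfold atomAngle at ha
  field_simp at ha
  exact_mod_cast ha

open Polynomial

theorem eval_S_xatom {n j : ℕ} (hj : j ∈ Finset.Icc 1 n) :
    (Chebyshev.S ℂ n).eval (xatom n j : ℂ) = 0 := by
  have h := Chebyshev.S_two_mul_complex_cos (atomAngle n j) n
  rw [Int.cast_natCast, sin_add_one_mul_atomAngle, ← xatom_eq] at h
  exact (mul_eq_zero.mp h).resolve_right (sin_atomAngle_ne_zero hj)

theorem eval_S_sub_one_xatom {n j : ℕ} (hj : j ∈ Finset.Icc 1 n) :
    (Chebyshev.S ℂ (n - 1)).eval (xatom n j : ℂ) =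
      -Complex.cos (((n : ℂ) + 1) * atomAngle n j) := by
  have h := Chebyshev.S_two_mul_complex_cos (atomAngle n j) (n - 1)
  have ha : (((n : ℤ) - 1 : ℤ) + 1 : ℂ) * atomAngle n j =
      ((n : ℂ) + 1) * atomAngle n j - atomAngle n j := by
    push_cast
    ring
  rw [ha, Complex.sin_sub, sin_add_one_mul_atomAngle, ← xatom_eq] at h
  apply mul_right_cancel₀ (sin_atomAngle_ne_zero hj)
  rw [h]
  ring

theorem nodal_xatom (n : ℕ) :
    Lagrange.nodal (Finset.Icc 1 n) (fun j ↦ (xatom n j : ℂ)) = Chebyshev.S ℂ n := by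
  have hdeg : (Lagrange.nodal (Finset.Icc 1 n) (fun j ↦ (xatom n j : ℂ))).degree = n := by
    simp [Lagrange.degree_nodal]
  refine eq_of_degree_le_of_eval_index_eq _ (xatom_injOn n) (by simp [hdeg])
    (hdeg.trans (Chebyshev.degree_S_natCast ℂ n).symm) ?_ fun j hj ↦ ?_
  · rw [Lagrange.nodal_monic.leadingCoeff,
      (Chebyshev.monic_S_and_natDegree_S ℂ n).1.leadingCoeff]
  · exact (Lagrange.eval_nodal_at_node (v := fun j ↦ (xatom n j : ℂ)) hj).trans
      (eval_S_xatom hj).symm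

theorem aatom_eq_nodalWeight_mul {n j : ℕ} (hj : j ∈ Finset.Icc 1 n) :
    (aatom n j : ℂ) =
      Lagrange.nodalWeight (Finset.Icc 1 n) (fun j ↦ (xatom n j : ℂ)) j *
        (Chebyshev.S ℂ (n - 1)).eval (xatom n j : ℂ) := by
  have hd := Chebyshev.derivative_S_two_mul_complex_cos n (atomAngle n j)
  rw [← xatom_eq, eval_S_xatom hj, Int.cast_natCast] at hd
  have hs := sin_atomAngle_ne_zero hj
  have hc := cos_add_one_mul_atomAngle_sq n j
  have hn : (n : ℂ) + 1 ≠ 0 := by exact_mod_cast n.succ_ne_zero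
  rw [Lagrange.nodalWeight_eq_eval_derivative_nodal hj, nodal_xatom, eval_S_sub_one_xatom hj,
    aatom_eq]
  generalize Complex.cos (((n : ℂ) + 1) * atomAngle n j) = c at *
  have hc0 : c ≠ 0 := by
    rintro rfl
    simp at hc
  have hD : (derivative (Chebyshev.S ℂ n)).eval (xatom n j : ℂ) ≠ 0 := by
    intro h0
    simp [h0, hc0, hn] at hd
  rw [div_eq_iff hn]
  field_simp
  linear_combination -hd

theorem ne_xatom {z : ℂ} (hz : z.im ≠ 0) (n j : ℕ) : z ≠ xatom n j := by
  rintro rfl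
  simp at hz

theorem eval_S_ne_zero {z : ℂ} (hz : z.im ≠ 0) (n : ℕ) : (Chebyshev.S ℂ n).eval z ≠ 0 := by
  rw [← nodal_xatom]
  exact Lagrange.eval_nodal_not_at_node fun j _ ↦ ne_xatom hz n j

theorem Gtrans_eq_div {n : ℕ} (hn : 1 ≤ n) {z : ℂ} (hz : z.im ≠ 0) :
    Gtrans n z = (Chebyshev.S ℂ (n - 1)).eval z / (Chebyshev.S ℂ n).eval z := by
  have hdeg : (Chebyshev.S ℂ (n - 1)).degree < (Finset.Icc 1 n).card := by
    rw [← Nat.cast_pred hn, Chebyshev.degree_S_natCast, Nat.card_Icc]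
    exact_mod_cast (by lia : n - 1 < n + 1 - 1)
  rw [eq_div_iff (eval_S_ne_zero hz n),
    Lagrange.eq_interpolate (xatom_injOn n) hdeg,
    Lagrange.eval_interpolate_not_at_node _ fun j _ ↦ ne_xatom hz n j, nodal_xatom, mul_comm,
    Gtrans]
  congr 1
  refine Finset.sum_congr rfl fun j hj ↦ ?_
  rw [aatom_eq_nodalWeight_mul hj]
  ring

theorem stmt5 : ∀ n : ℕ, 2 ≤ n → ∀ z : ℂ, z.im ≠ 0 →
    z - Gtrans (n - 1) z ≠ 0 ∧ Gtrans n z = 1 / (z - Gtrans (n - 1) z) := by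
  intro n hn z hz
  obtain ⟨m, rfl⟩ : ∃ m, n = m + 1 := ⟨n - 1, by lia⟩
  have hm := eval_S_ne_zero hz m
  have hm1 := eval_S_ne_zero hz (m + 1)
  rw [Nat.add_sub_cancel, Gtrans_eq_div (by lia) hz, Gtrans_eq_div (by lia) hz]
  push_cast at hm1 ⊢
  rw [add_sub_cancel_right]
  have key : z - (Chebyshev.S ℂ (m - 1)).eval z / (Chebyshev.S ℂ m).eval z =
      (Chebyshev.S ℂ (m + 1)).eval z / (Chebyshev.S ℂ m).eval z := by
    rw [Chebyshev.S_add_one, eval_sub, eval_mul, eval_X]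
    field_simp
  rw [key, one_div_div]
  exact ⟨div_ne_zero hm1 hm, rfl⟩
end

section
/- Let t be a real number and n ≥ 1 an integer. Then ∑_{π} t^(o(π)) · (t−1)^(i(π)) = t^(2n) − (t/2)·∑_{k=1}^{n} (1/(2k−1))·binomial(2k,k)·(t−1)^k·t^(2(n−k)), where the sum on the left is over all non-crossing pair partitions π of {1,…,2n}, o(π) is the number of pairs of π of depth 1 (outer pairs), and i(π) is the number of pairs of π of depth at least 2 (inner pairs). -/
open Classical in
/-- The (finite) collection of all non-crossing pair partitions of `{1, …, 2n}`. -/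
noncomputable def NCP2 (n : ℕ) : Finset (Finset (Finset ℕ)) :=
  ((Finset.Icc 1 (2 * n)).powerset.powerset).filter
    (fun π => IsPairPartition (2 * n) π ∧ NonCrossing π)

/-- `o(π)`: the number of pairs of `π` of depth `1` (outer pairs). -/
noncomputable def outerNum (π : Finset (Finset ℕ)) : ℕ :=
  Set.ncard {P : Finset ℕ | P ∈ π ∧ pairDepth π P = 1}

/-- `i(π)`: the number of pairs of `π` of depth at least `2` (inner pairs). -/
noncomputable def innerNum (π : Finset (Finset ℕ)) : ℕ :=
  Set.ncard {P : Finset ℕ | P ∈ π ∧ 2 ≤ pairDepth π P}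

section

open Finset

/-- `π` is a non-crossing pairing of the integer interval `[a, b)`. -/
structure IsNCPairing (a b : ℕ) (π : Finset (Finset ℕ)) : Prop where
  card_eq : ∀ P ∈ π, P.card = 2
  cover : ∀ i : ℕ, (∃ P ∈ π, i ∈ P) ↔ a ≤ i ∧ i < b
  disj : ∀ P ∈ π, ∀ Q ∈ π, P ≠ Q → Disjoint P Q
  nonCrossing : NonCrossing π

open Classical in
/-- The non-crossing pairings of the integer interval `[a, b)`. -/
noncomputable def ncPairings (a b : ℕ) : Finset (Finset (Finset ℕ)) :=
  ((Finset.Ico a b).powerset.powerset).filter (IsNCPairing a b)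

theorem mem_ncPairings {a b : ℕ} {π : Finset (Finset ℕ)} :
    π ∈ ncPairings a b ↔ IsNCPairing a b π := by
  simp only [ncPairings, mem_filter, mem_powerset, and_iff_right_iff_imp]
  intro h P hP
  rw [mem_powerset]
  intro i hi
  exact mem_Ico.2 ((h.cover i).1 ⟨P, hP, hi⟩)

theorem NCP2_eq_ncPairings (n : ℕ) : NCP2 n = ncPairings 1 (2 * n + 1) := by
  classical
  ext π
  rw [mem_ncPairings, NCP2, mem_filter, mem_powerset]
  constructor
  · rintro ⟨-, ⟨h1, h2, h3⟩, h4⟩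
    refine ⟨h1, fun i => ?_, h3, h4⟩
    rw [h2, mem_Icc]
    omega
  · intro h
    have h2 : ∀ i : ℕ, (∃ P ∈ π, i ∈ P) ↔ i ∈ Finset.Icc 1 (2 * n) := fun i => by
      rw [h.cover, mem_Icc]
      omega
    refine ⟨fun P hP => ?_, ⟨h.card_eq, h2, h.disj⟩, h.nonCrossing⟩
    rw [mem_powerset]
    exact fun i hi => (h2 i).1 ⟨P, hP, hi⟩

namespace IsNCPairing

variable {a b p : ℕ} {π σ τ : Finset (Finset ℕ)}

theorem bounds (h : IsNCPairing a b π) {P : Finset ℕ} (hP : P ∈ π) {i : ℕ} (hi : i ∈ P) :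
    a ≤ i ∧ i < b :=
  (h.cover i).1 ⟨P, hP, hi⟩

theorem exists_mem (h : IsNCPairing a b π) {P : Finset ℕ} (hP : P ∈ π) : ∃ i, i ∈ P :=
  card_pos.1 (by rw [h.card_eq P hP]; norm_num)

theorem eq_of_mem (h : IsNCPairing a b π) {P Q : Finset ℕ} (hP : P ∈ π) (hQ : Q ∈ π) {i : ℕ}
    (hiP : i ∈ P) (hiQ : i ∈ Q) : P = Q := by
  by_contra hne
  exact disjoint_left.1 (h.disj P hP Q hQ hne) hiP hiQ

theorem length_eq (h : IsNCPairing a b π) : b - a = 2 * π.card := by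
  have hU : π.biUnion (fun P => P) = Finset.Ico a b := by
    ext i
    simp only [mem_biUnion, mem_Ico]
    exact h.cover i
  rw [← Nat.card_Ico, ← hU, card_biUnion (fun P hP Q hQ hne => h.disj P hP Q hQ hne),
    sum_congr rfl (fun P hP => h.card_eq P hP), sum_const, smul_eq_mul, mul_comm]

end IsNCPairing

/-- The pairing of `[a, b)` made of the arc `{a, p}`, a pairing `σ` of `[a + 1, p)` and a pairing
`τ` of `[p + 1, b)`. -/
def arcJoin (a p : ℕ) (σ τ : Finset (Finset ℕ)) : Finset (Finset ℕ) :=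
  insert {a, p} (σ ∪ τ)

theorem mem_arcJoin {a p : ℕ} {σ τ : Finset (Finset ℕ)} {P : Finset ℕ} :
    P ∈ arcJoin a p σ τ ↔ P = {a, p} ∨ P ∈ σ ∨ P ∈ τ := by
  simp [arcJoin]

namespace IsNCPairing

variable {a b p : ℕ} {π σ τ : Finset (Finset ℕ)}

theorem arcJoin (hap : a < p) (hpb : p < b) (hσ : IsNCPairing (a + 1) p σ)
    (hτ : IsNCPairing (p + 1) b τ) : IsNCPairing a b (arcJoin a p σ τ) := by
  have bσ : ∀ P ∈ σ, ∀ i ∈ P, a + 1 ≤ i ∧ i < p := fun P hP i hi => hσ.bounds hP hi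
  have bτ : ∀ P ∈ τ, ∀ i ∈ P, p + 1 ≤ i ∧ i < b := fun P hP i hi => hτ.bounds hP hi
  refine ⟨fun P hP => ?_, fun i => ⟨?_, fun hi => ?_⟩, fun P hP Q hQ hne => ?_,
    fun P hP Q hQ hne => ?_⟩
  · rcases mem_arcJoin.1 hP with rfl | hP | hP
    · exact card_pair hap.ne
    · exact hσ.card_eq P hP
    · exact hτ.card_eq P hP
  · rintro ⟨P, hP, hi⟩
    rcases mem_arcJoin.1 hP with rfl | hP | hP
    · rw [mem_insert, mem_singleton] at hi
      omega
    · have := bσ P hP i hi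
      omega
    · have := bτ P hP i hi
      omega
  · by_cases h0 : i = a ∨ i = p
    · exact ⟨{a, p}, mem_arcJoin.2 (Or.inl rfl), by simpa using h0⟩
    · rcases lt_or_ge i p with hip | hip
      · obtain ⟨P, hP, hiP⟩ := (hσ.cover i).2 (by omega)
        exact ⟨P, mem_arcJoin.2 (Or.inr (Or.inl hP)), hiP⟩
      · obtain ⟨P, hP, hiP⟩ := (hτ.cover i).2 (by omega)
        exact ⟨P, mem_arcJoin.2 (Or.inr (Or.inr hP)), hiP⟩
  · rw [disjoint_left]
    intro i hiP hiQ
    rcases mem_arcJoin.1 hP with rfl | hP | hP <;> rcases mem_arcJoin.1 hQ with rfl | hQ | hQ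
    · exact hne rfl
    · have := bσ Q hQ i hiQ
      rw [mem_insert, mem_singleton] at hiP
      omega
    · have := bτ Q hQ i hiQ
      rw [mem_insert, mem_singleton] at hiP
      omega
    · have := bσ P hP i hiP
      rw [mem_insert, mem_singleton] at hiQ
      omega
    · exact hne (hσ.eq_of_mem hP hQ hiP hiQ)
    · have := bσ P hP i hiP
      have := bτ Q hQ i hiQ
      omega
    · have := bτ P hP i hiP
      rw [mem_insert, mem_singleton] at hiQ
      omega
    · have := bτ P hP i hiP
      have := bσ Q hQ i hiQ
      omega
    · exact hne (hτ.eq_of_mem hP hQ hiP hiQ)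
  · rintro ⟨w, hw, x, hx, y, hy, z, hz, hwx, hxy, hyz⟩
    rcases mem_arcJoin.1 hP with rfl | hP | hP <;> rcases mem_arcJoin.1 hQ with rfl | hQ | hQ
    · exact hne rfl
    · have := bσ Q hQ z hz
      rw [mem_insert, mem_singleton] at hy hw
      omega
    · have := bτ Q hQ x hx
      rw [mem_insert, mem_singleton] at hy
      omega
    · have := bσ P hP w hw
      have := bσ P hP y hy
      rw [mem_insert, mem_singleton] at hx
      omega
    · exact hσ.nonCrossing P hP Q hQ hne ⟨w, hw, x, hx, y, hy, z, hz, hwx, hxy, hyz⟩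
    · have := bσ P hP y hy
      have := bτ Q hQ x hx
      omega
    · have := bτ P hP w hw
      rw [mem_insert, mem_singleton] at hx
      omega
    · have := bτ P hP w hw
      have := bσ Q hQ x hx
      omega
    · exact hτ.nonCrossing P hP Q hQ hne ⟨w, hw, x, hx, y, hy, z, hz, hwx, hxy, hyz⟩

theorem exists_eq_arcJoin (h : IsNCPairing a b π) (hab : a < b) :
    ∃ p σ τ, a < p ∧ p < b ∧ IsNCPairing (a + 1) p σ ∧ IsNCPairing (p + 1) b τ ∧
      π = _root_.arcJoin a p σ τ := by
  classical
  obtain ⟨A, hA, haA⟩ := (h.cover a).2 ⟨le_rfl, hab⟩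
  obtain ⟨p, hpa, rfl⟩ : ∃ p, p ≠ a ∧ A = {a, p} := by
    obtain ⟨x, y, hxy, rfl⟩ := card_eq_two.1 (h.card_eq A hA)
    rw [mem_insert, mem_singleton] at haA
    rcases haA with rfl | rfl
    · exact ⟨y, hxy.symm, rfl⟩
    · exact ⟨x, hxy, pair_comm _ _⟩
  have hpA : p ∈ ({a, p} : Finset ℕ) := by simp
  have hp := h.bounds hA hpA
  have hap : a < p := by omega
  have avoid : ∀ Q ∈ π, Q ≠ {a, p} → ∀ x ∈ Q, a < x ∧ x ≠ p := by
    intro Q hQ hne x hx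
    have h1 := h.bounds hQ hx
    have h2 : x ≠ a := by
      rintro rfl
      exact hne (h.eq_of_mem hQ hA hx haA)
    refine ⟨by omega, ?_⟩
    rintro rfl
    exact hne (h.eq_of_mem hQ hA hx hpA)
  have side : ∀ Q ∈ π, Q ≠ {a, p} → ∀ x ∈ Q, ∀ y ∈ Q, x < p → y < p := by
    intro Q hQ hne x hx y hy hxp
    by_contra hyp
    have := avoid Q hQ hne x hx
    have := avoid Q hQ hne y hy
    exact h.nonCrossing _ hA Q hQ hne.symm
      ⟨a, haA, x, hx, p, hpA, y, hy, by omega, hxp, by omega⟩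
  have sub : ∀ (c d : ℕ) (ρ : Finset (Finset ℕ)), ρ ⊆ π →
      (∀ i, (∃ P ∈ ρ, i ∈ P) ↔ c ≤ i ∧ i < d) → IsNCPairing c d ρ := fun c d ρ hρ hc =>
    ⟨fun P hP => h.card_eq P (hρ hP), hc,
      fun P hP Q hQ hne => h.disj P (hρ hP) Q (hρ hQ) hne,
      fun P hP Q hQ hne => h.nonCrossing P (hρ hP) Q (hρ hQ) hne⟩
  refine ⟨p, π.filter (fun Q => Q ≠ {a, p} ∧ ∀ x ∈ Q, x < p),
    π.filter (fun Q => Q ≠ {a, p} ∧ ∀ x ∈ Q, p < x), hap, hp.2,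
    sub _ _ _ (filter_subset _ _) fun i => ⟨?_, fun hi => ?_⟩,
    sub _ _ _ (filter_subset _ _) fun i => ⟨?_, fun hi => ?_⟩, ?_⟩
  · rintro ⟨P, hP, hi⟩
    obtain ⟨hP, hne, hlt⟩ := mem_filter.1 hP
    have := avoid P hP hne i hi
    exact ⟨this.1, hlt i hi⟩
  · obtain ⟨Q, hQ, hiQ⟩ := (h.cover i).2 (by omega)
    have hne : Q ≠ {a, p} := by
      rintro rfl
      rw [mem_insert, mem_singleton] at hiQ
      omega
    exact ⟨Q, mem_filter.2 ⟨hQ, hne, fun x hx => side Q hQ hne i hiQ x hx hi.2⟩, hiQ⟩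
  · rintro ⟨P, hP, hi⟩
    obtain ⟨hP, hne, hlt⟩ := mem_filter.1 hP
    exact ⟨hlt i hi, (h.bounds hP hi).2⟩
  · obtain ⟨Q, hQ, hiQ⟩ := (h.cover i).2 (by omega)
    have hne : Q ≠ {a, p} := by
      rintro rfl
      rw [mem_insert, mem_singleton] at hiQ
      omega
    refine ⟨Q, mem_filter.2 ⟨hQ, hne, fun x hx => ?_⟩, hiQ⟩
    by_contra hxp
    have := avoid Q hQ hne x hx
    have := side Q hQ hne x hx i hiQ (by omega)
    omega
  · ext Q
    simp only [mem_arcJoin, mem_filter]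
    constructor
    · intro hQ
      by_cases hne : Q = {a, p}
      · exact Or.inl hne
      · right
        obtain ⟨x, hx⟩ := h.exists_mem hQ
        have hxp := (avoid Q hQ hne x hx).2
        rcases lt_or_gt_of_ne hxp with hlt | hgt
        · exact Or.inl ⟨hQ, hne, fun y hy => side Q hQ hne x hx y hy hlt⟩
        · refine Or.inr ⟨hQ, hne, fun y hy => ?_⟩
          by_contra hyp
          have := avoid Q hQ hne y hy
          have := side Q hQ hne y hy x hx (by omega)
          omega
    · rintro (rfl | hQ | hQ)
      · exact hA
      · exact hQ.1
      · exact hQ.1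

end IsNCPairing

section Join

variable {a b p : ℕ} {σ τ : Finset (Finset ℕ)}

theorem arcJoin_filter_inside (hσ : IsNCPairing (a + 1) p σ) (hτ : IsNCPairing (p + 1) b τ) :
    (arcJoin a p σ τ).filter (fun P => ∀ x ∈ P, x < p) = σ := by
  ext P
  rw [mem_filter, mem_arcJoin]
  constructor
  · rintro ⟨rfl | hP | hP, hlt⟩
    · exact absurd (hlt p (by simp)) (lt_irrefl p)
    · exact hP
    · obtain ⟨x, hx⟩ := hτ.exists_mem hP
      have := hlt x hx
      have := hτ.bounds hP hx
      omega
  · exact fun hP => ⟨Or.inr (Or.inl hP), fun x hx => (hσ.bounds hP hx).2⟩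

theorem arcJoin_filter_after (hap : a < p) (hσ : IsNCPairing (a + 1) p σ)
    (hτ : IsNCPairing (p + 1) b τ) :
    (arcJoin a p σ τ).filter (fun P => ∀ x ∈ P, p < x) = τ := by
  ext P
  rw [mem_filter, mem_arcJoin]
  constructor
  · rintro ⟨rfl | hP | hP, hlt⟩
    · exact absurd (hlt a (by simp)) hap.not_gt
    · obtain ⟨x, hx⟩ := hσ.exists_mem hP
      have := hlt x hx
      have := hσ.bounds hP hx
      omega
    · exact hP
  · exact fun hP => ⟨Or.inr (Or.inr hP), fun x hx => (hτ.bounds hP hx).1⟩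

theorem arcJoin_injective {p' : ℕ} {σ' τ' : Finset (Finset ℕ)} (hap : a < p) (hpb : p < b)
    (hap' : a < p')
    (hσ : IsNCPairing (a + 1) p σ) (hτ : IsNCPairing (p + 1) b τ)
    (hσ' : IsNCPairing (a + 1) p' σ') (hτ' : IsNCPairing (p' + 1) b τ')
    (h : arcJoin a p σ τ = arcJoin a p' σ' τ') : p = p' ∧ σ = σ' ∧ τ = τ' := by
  have hp : p = p' := by
    have h1 : ({a, p} : Finset ℕ) ∈ arcJoin a p σ τ := mem_arcJoin.2 (Or.inl rfl)
    have h2 : ({a, p'} : Finset ℕ) ∈ arcJoin a p σ τ := h ▸ mem_arcJoin.2 (Or.inl rfl)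
    have h3 : p ∈ ({a, p'} : Finset ℕ) :=
      (hσ.arcJoin hap hpb hτ).eq_of_mem h1 h2 (i := a) (by simp) (by simp) ▸ (by simp)
    rw [mem_insert, mem_singleton] at h3
    omega
  subst hp
  refine ⟨rfl, ?_, ?_⟩
  · rw [← arcJoin_filter_inside hσ hτ, h, arcJoin_filter_inside hσ' hτ']
  · rw [← arcJoin_filter_after hap hσ hτ, h, arcJoin_filter_after hap hσ' hτ']

end Join

theorem sum_ncPairings_succ {M : Type*} [AddCommMonoid M] (f : Finset (Finset ℕ) → M)
    (a n : ℕ) :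
    ∑ π ∈ ncPairings a (a + 2 * (n + 1)), f π =
      ∑ jk ∈ antidiagonal n,
        ∑ στ ∈ ncPairings (a + 1) (a + 1 + 2 * jk.1) ×ˢ
          ncPairings (a + 2 * jk.1 + 2) (a + 2 * jk.1 + 2 + 2 * jk.2),
          f (arcJoin a (a + 2 * jk.1 + 1) στ.1 στ.2) := by
  rw [sum_sigma']
  symm
  have key : ∀ x ∈ (antidiagonal n).sigma (fun jk =>
      ncPairings (a + 1) (a + 1 + 2 * jk.1) ×ˢ
          ncPairings (a + 2 * jk.1 + 2) (a + 2 * jk.1 + 2 + 2 * jk.2)),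
      x.1.1 + x.1.2 = n ∧ IsNCPairing (a + 1) (a + 2 * x.1.1 + 1) x.2.1 ∧
        IsNCPairing (a + 2 * x.1.1 + 1 + 1) (a + 2 * (n + 1)) x.2.2 := by
    rintro ⟨⟨j, k⟩, σ, τ⟩ hx
    simp only [mem_sigma, HasAntidiagonal.mem_antidiagonal, mem_product, mem_ncPairings] at hx ⊢
    obtain ⟨rfl, hσ, hτ⟩ := hx
    refine ⟨rfl, ?_, ?_⟩
    · convert hσ using 1
      omega
    · convert hτ using 1
      omega
  refine sum_nbij (fun x => arcJoin a (a + 2 * x.1.1 + 1) x.2.1 x.2.2) ?_ ?_ ?_ ?_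
  · intro x hx
    obtain ⟨hn, hσ, hτ⟩ := key x hx
    exact mem_ncPairings.2 (hσ.arcJoin (by omega) (by omega) hτ)
  · intro x hx y hy hxy
    obtain ⟨hn, hσ, hτ⟩ := key x hx
    obtain ⟨hn', hσ', hτ'⟩ := key y hy
    obtain ⟨h1, h2, h3⟩ :=
      arcJoin_injective (by omega) (by omega) (by omega) hσ hτ hσ' hτ' hxy
    obtain ⟨⟨j, k⟩, σ, τ⟩ := x
    obtain ⟨⟨j', k'⟩, σ', τ'⟩ := y
    simp only at h1 h2 h3 hn hn'
    obtain rfl : j = j' := by omega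
    obtain rfl : k = k' := by omega
    subst h2 h3
    rfl
  · intro π hπ
    obtain ⟨p, σ, τ, hap, hpb, hσ, hτ, rfl⟩ :=
      (mem_ncPairings.1 hπ).exists_eq_arcJoin (by omega)
    have h1 := hσ.length_eq
    have h2 := hτ.length_eq
    obtain rfl : p = a + 2 * σ.card + 1 := by omega
    refine ⟨⟨(σ.card, τ.card), σ, τ⟩, ?_, rfl⟩
    simp only [coe_sigma, Set.mem_sigma_iff, mem_coe,
      HasAntidiagonal.mem_antidiagonal, mem_product, mem_ncPairings]
    refine ⟨by omega, ?_, ?_⟩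
    · convert hσ using 1
      omega
    · convert hτ using 1
      omega
  · intro x hx
    rfl

theorem ncPairings_self (a : ℕ) : ncPairings a a = {∅} := by
  ext π
  rw [mem_ncPairings, mem_singleton]
  constructor
  · intro h
    have := h.length_eq
    exact card_eq_zero.1 (by omega)
  · rintro rfl
    refine ⟨by simp, fun i => ?_, by simp, fun P hP => by simp at hP⟩
    simp only [notMem_empty, false_and, exists_false, false_iff]
    omega

theorem card_ncPairings (n : ℕ) : ∀ a : ℕ, (ncPairings a (a + 2 * n)).card = catalan n := by
  induction n using Nat.strong_induction_on with
  | _ n ih =>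
    intro a
    cases n with
    | zero => simp [ncPairings_self]
    | succ n =>
      rw [card_eq_sum_ones, sum_ncPairings_succ, catalan_succ']
      refine sum_congr rfl fun jk hjk => ?_
      have := HasAntidiagonal.mem_antidiagonal.1 hjk
      rw [← card_eq_sum_ones, card_product, ih _ (by omega), ih _ (by omega)]

open Classical in
/-- The product over the pairs of `π` of `t` for outer pairs and `u` for inner pairs. -/
noncomputable def nestingWeight {R : Type*} [CommSemiring R] (t u : R)
    (π : Finset (Finset ℕ)) : R :=
  ∏ P ∈ π, if ∃ Q ∈ π, Nested P Q then u else t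

theorem nestingWeight_arcJoin {R : Type*} [CommSemiring R] (t u : R) {a b p : ℕ}
    {σ τ : Finset (Finset ℕ)} (hap : a < p) (hσ : IsNCPairing (a + 1) p σ)
    (hτ : IsNCPairing (p + 1) b τ) :
    nestingWeight t u (arcJoin a p σ τ) = t * (u ^ σ.card * nestingWeight t u τ) := by
  classical
  have hdisj : Disjoint σ τ := by
    rw [disjoint_left]
    intro P hP hP'
    obtain ⟨x, hx⟩ := hσ.exists_mem hP
    have := hσ.bounds hP hx
    have := hτ.bounds hP' hx
    omega
  have hnot : ({a, p} : Finset ℕ) ∉ σ ∪ τ := by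
    intro h
    rcases mem_union.1 h with h | h
    · have := hσ.bounds h (i := a) (by simp)
      omega
    · have := hτ.bounds h (i := a) (by simp)
      omega
  have harc : ¬ ∃ Q ∈ arcJoin a p σ τ, Nested {a, p} Q := by
    rintro ⟨Q, hQ, c, hc, d, hd, h⟩
    have h1 := (h a (by simp)).1
    rcases mem_arcJoin.1 hQ with rfl | hQ | hQ
    · rw [mem_insert, mem_singleton] at hc
      omega
    · have := hσ.bounds hQ hc
      omega
    · have := hτ.bounds hQ hc
      omega
  have hin : ∀ P ∈ σ, ∃ Q ∈ arcJoin a p σ τ, Nested P Q := fun P hP =>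
    ⟨{a, p}, mem_arcJoin.2 (Or.inl rfl), a, by simp, p, by simp, fun x hx => hσ.bounds hP hx⟩
  have hout : ∀ P ∈ τ, (∃ Q ∈ arcJoin a p σ τ, Nested P Q) ↔ ∃ Q ∈ τ, Nested P Q := by
    intro P hP
    constructor
    · rintro ⟨Q, hQ, hPQ⟩
      refine ⟨Q, ?_, hPQ⟩
      obtain ⟨c, hc, d, hd, h⟩ := hPQ
      obtain ⟨x, hx⟩ := hτ.exists_mem hP
      have h1 := h x hx
      have h2 := hτ.bounds hP hx
      rcases mem_arcJoin.1 hQ with rfl | hQ | hQ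
      · rw [mem_insert, mem_singleton] at hd
        omega
      · have := hσ.bounds hQ hd
        omega
      · exact hQ
    · rintro ⟨Q, hQ, hPQ⟩
      exact ⟨Q, mem_arcJoin.2 (Or.inr (Or.inr hQ)), hPQ⟩
  rw [nestingWeight, nestingWeight]
  conv_lhs => rw [arcJoin, prod_insert hnot, ← arcJoin, prod_union hdisj]
  rw [if_neg harc, prod_congr rfl (fun P hP => if_pos (hin P hP)), prod_const]
  congr 2
  refine prod_congr rfl fun P hP => ?_
  simp only [hout P hP]

theorem pairDepth_eq_one_iff {π : Finset (Finset ℕ)} {P : Finset ℕ} (hP : P ∈ π)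
    (hne : P.Nonempty) : pairDepth π P = 1 ↔ ¬ ∃ Q ∈ π, Nested P Q := by
  have hself : ¬ Nested P P := by
    rintro ⟨c, hc, d, hd, h⟩
    exact lt_irrefl c (h c hc).1
  rw [pairDepth, Set.ncard_eq_one]
  constructor
  · rintro ⟨R, hR⟩ ⟨Q, hQ, hPQ⟩
    have h1 : P ∈ ({R} : Set (Finset ℕ)) := hR ▸ ⟨hP, Or.inl rfl⟩
    have h2 : Q ∈ ({R} : Set (Finset ℕ)) := hR ▸ ⟨hQ, Or.inr hPQ⟩
    rw [Set.mem_singleton_iff] at h1 h2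
    exact hself (by rw [h2, ← h1] at hPQ; exact hPQ)
  · intro h
    refine ⟨P, Set.ext fun Q => ⟨?_, ?_⟩⟩
    · rintro ⟨hQ, hQP | hPQ⟩
      · exact hQP
      · exact absurd ⟨Q, hQ, hPQ⟩ h
    · rintro rfl
      exact ⟨hP, Or.inl rfl⟩

theorem pairDepth_pos {π : Finset (Finset ℕ)} {P : Finset ℕ} (hP : P ∈ π) :
    0 < pairDepth π P := by
  rw [pairDepth, Set.ncard_pos (π.finite_toSet.subset fun Q hQ => hQ.1)]
  exact ⟨P, hP, Or.inl rfl⟩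

theorem pow_outerNum_mul_pow_innerNum {R : Type*} [CommSemiring R] (t u : R) {a b : ℕ}
    {π : Finset (Finset ℕ)} (h : IsNCPairing a b π) :
    t ^ outerNum π * u ^ innerNum π = nestingWeight t u π := by
  classical
  have hiff : ∀ P ∈ π, pairDepth π P = 1 ↔ ¬ ∃ Q ∈ π, Nested P Q := fun P hP =>
    pairDepth_eq_one_iff hP (h.exists_mem hP)
  have ho : outerNum π = (π.filter fun P => ¬ ∃ Q ∈ π, Nested P Q).card := by
    rw [outerNum, ← Set.ncard_coe_finset]
    congr 1
    ext P
    simp only [Set.mem_ofPred_eq, mem_coe, mem_filter]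
    exact and_congr_right (hiff P)
  have hi : innerNum π = (π.filter fun P => ∃ Q ∈ π, Nested P Q).card := by
    rw [innerNum, ← Set.ncard_coe_finset]
    congr 1
    ext P
    simp only [Set.mem_ofPred_eq, mem_coe, mem_filter]
    refine and_congr_right fun hP => ?_
    rw [← not_iff_not, ← hiff P hP]
    have := pairDepth_pos hP
    omega
  rw [nestingWeight, prod_ite, prod_const, prod_const, ho, hi, mul_comm]

theorem sum_nestingWeight_succ {R : Type*} [CommSemiring R] (t u : R) (a n : ℕ) :
    ∑ π ∈ ncPairings a (a + 2 * (n + 1)), nestingWeight t u π =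
      ∑ jk ∈ antidiagonal n, t * ((catalan jk.1 : R) * u ^ jk.1 *
        ∑ τ ∈ ncPairings (a + 2 * jk.1 + 2) (a + 2 * jk.1 + 2 + 2 * jk.2),
          nestingWeight t u τ) := by
  rw [sum_ncPairings_succ]
  refine sum_congr rfl fun jk _ => ?_
  have key : ∀ στ ∈ ncPairings (a + 1) (a + 1 + 2 * jk.1) ×ˢ
      ncPairings (a + 2 * jk.1 + 2) (a + 2 * jk.1 + 2 + 2 * jk.2),
      nestingWeight t u (arcJoin a (a + 2 * jk.1 + 1) στ.1 στ.2) =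
        t * (u ^ jk.1 * nestingWeight t u στ.2) := by
    rintro ⟨σ, τ⟩ h
    simp only [mem_product, mem_ncPairings] at h
    obtain ⟨hσ, hτ⟩ := h
    have hcard : σ.card = jk.1 := by
      have := hσ.length_eq
      omega
    rw [show a + 1 + 2 * jk.1 = a + 2 * jk.1 + 1 by ring] at hσ
    rw [nestingWeight_arcJoin t u (by omega) hσ hτ, hcard]
  rw [sum_congr rfl key, sum_product]
  simp only
  rw [sum_const, card_ncPairings, nsmul_eq_mul, ← mul_sum,
    ← mul_sum]
  ring

theorem sum_nestingWeight_eq (t : ℝ) {F : ℕ → ℝ} (h0 : F 0 = 1)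
    (hF : ∀ n, F (n + 1) = ∑ jk ∈ antidiagonal n,
      t * ((catalan jk.1 : ℝ) * (t - 1) ^ jk.1 * F jk.2)) (n : ℕ) :
    ∀ a : ℕ, ∑ π ∈ ncPairings a (a + 2 * n), nestingWeight t (t - 1) π = F n := by
  induction n using Nat.strong_induction_on with
  | _ n ih =>
    intro a
    cases n with
    | zero => simp [ncPairings_self, nestingWeight, h0]
    | succ n =>
      rw [sum_nestingWeight_succ, hF]
      refine sum_congr rfl fun jk hjk => ?_
      have := HasAntidiagonal.mem_antidiagonal.1 hjk
      rw [ih _ (by omega)]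

/-- The power series `∑ catalan n * (t - 1) ^ n * X ^ n` turns the convolution recurrence with
kernel `t * catalan j * (t - 1) ^ j` into a first-order one. -/
theorem convolution_of_catalan_recurrence (t : ℝ) {F : ℕ → ℝ} (h0 : F 0 = 1)
    (hF : ∀ n, F (n + 1) = t ^ 2 * F n - t * (t - 1) ^ (n + 1) * catalan n) (n : ℕ) :
    F (n + 1) = ∑ jk ∈ antidiagonal n, t * ((catalan jk.1 : ℝ) * (t - 1) ^ jk.1 * F jk.2) := by
  set K : PowerSeries ℝ := PowerSeries.mk fun n => (catalan n : ℝ) * (t - 1) ^ n with hK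
  set G : PowerSeries ℝ := PowerSeries.mk F with hG
  have hKeq : K = 1 + PowerSeries.C (t - 1) * (PowerSeries.X * (K * K)) := by
    ext n
    cases n with
    | zero => simp [hK]
    | succ n =>
      rw [map_add, PowerSeries.coeff_one, if_neg n.succ_ne_zero, zero_add,
        PowerSeries.coeff_C_mul, PowerSeries.coeff_succ_X_mul, PowerSeries.coeff_mul, hK,
        PowerSeries.coeff_mk, catalan_succ', Nat.cast_sum, sum_mul, mul_sum]
      refine sum_congr rfl fun jk hjk => ?_
      rw [← HasAntidiagonal.mem_antidiagonal.1 hjk, PowerSeries.coeff_mk, PowerSeries.coeff_mk]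
      push_cast
      ring
  have hGeq : G = 1 + PowerSeries.C (t ^ 2) * (PowerSeries.X * G) -
      PowerSeries.C (t * (t - 1)) * (PowerSeries.X * K) := by
    ext n
    cases n with
    | zero => simp [hG, h0]
    | succ n =>
      rw [map_sub, map_add, PowerSeries.coeff_one, if_neg n.succ_ne_zero, zero_add,
        PowerSeries.coeff_C_mul, PowerSeries.coeff_succ_X_mul, PowerSeries.coeff_C_mul,
        PowerSeries.coeff_succ_X_mul, hG, hK, PowerSeries.coeff_mk, PowerSeries.coeff_mk,
        PowerSeries.coeff_mk, hF]
      ring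
  have hne : (1 - PowerSeries.C (t ^ 2) * PowerSeries.X : PowerSeries ℝ) ≠ 0 := by
    intro h
    have := congrArg (PowerSeries.coeff 0) h
    simp at this
  have hconv : G = 1 + PowerSeries.C t * (PowerSeries.X * (K * G)) := by
    apply mul_left_cancel₀ hne
    simp only [map_sub, map_mul, map_pow, map_one] at hKeq hGeq ⊢
    linear_combination (1 - PowerSeries.C t * (PowerSeries.X * K)) * hGeq -
      PowerSeries.C t ^ 2 * PowerSeries.X * hKeq
  have := congrArg (PowerSeries.coeff (n + 1)) hconv
  rw [map_add, PowerSeries.coeff_one, if_neg n.succ_ne_zero, zero_add, PowerSeries.coeff_C_mul,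
    PowerSeries.coeff_succ_X_mul, PowerSeries.coeff_mul, hG, hK, PowerSeries.coeff_mk,
    mul_sum] at this
  simpa only [PowerSeries.coeff_mk] using this

theorem choose_two_mul_succ_eq_catalan (n : ℕ) :
    (2 * (n + 1)).choose (n + 1) = 2 * (2 * n + 1) * catalan n := by
  apply Nat.eq_of_mul_eq_mul_left n.succ_pos
  have h1 := Nat.succ_mul_centralBinom_succ n
  rw [Nat.centralBinom_eq_two_mul_choose, ← succ_mul_catalan_eq_centralBinom] at h1
  rw [Nat.succ_eq_add_one, h1]
  ring

end

theorem stmt6 (t : ℝ) (n : ℕ) (hn : 1 ≤ n) :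
    ∑ π ∈ NCP2 n, t ^ outerNum π * (t - 1) ^ innerNum π =
      t ^ (2 * n) - (t / 2) * ∑ k ∈ Finset.Icc 1 n,
        (1 / (2 * (k : ℝ) - 1)) * (Nat.choose (2 * k) k : ℝ) * (t - 1) ^ k *
          t ^ (2 * (n - k)) := by
  set F : ℕ → ℝ := fun n => t ^ (2 * n) - (t / 2) * ∑ k ∈ Finset.Icc 1 n,
        (1 / (2 * (k : ℝ) - 1)) * (Nat.choose (2 * k) k : ℝ) * (t - 1) ^ k *
          t ^ (2 * (n - k)) with hFdef
  have h0 : F 0 = 1 := by simp [hFdef]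
  have hF : ∀ n, F (n + 1) = t ^ 2 * F n - t * (t - 1) ^ (n + 1) * catalan n := by
    intro n
    have hshift : ∀ k ∈ Finset.Icc 1 n,
        (1 / (2 * (k : ℝ) - 1)) * (Nat.choose (2 * k) k : ℝ) * (t - 1) ^ k *
          t ^ (2 * (n + 1 - k)) =
        t ^ 2 * ((1 / (2 * (k : ℝ) - 1)) * (Nat.choose (2 * k) k : ℝ) * (t - 1) ^ k *
          t ^ (2 * (n - k))) := by
      intro k hk
      have := (Finset.mem_Icc.1 hk).2
      rw [show 2 * (n + 1 - k) = 2 * (n - k) + 2 by omega, pow_add]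
      ring
    have hpos : (2 * (n : ℝ) + 1) ≠ 0 := by positivity
    simp only [hFdef]
    rw [Finset.sum_Icc_succ_top (by omega), Finset.sum_congr rfl hshift, ← Finset.mul_sum,
      choose_two_mul_succ_eq_catalan, Nat.sub_self, mul_zero, pow_zero]
    push_cast
    rw [show 2 * ((n : ℝ) + 1) - 1 = 2 * n + 1 by ring]
    field_simp
    ring
  rw [NCP2_eq_ncPairings, add_comm, Finset.sum_congr rfl fun π hπ =>
    pow_outerNum_mul_pow_innerNum t (t - 1) (mem_ncPairings.1 hπ)]
  exact sum_nestingWeight_eq t h0 (convolution_of_catalan_recurrence t h0 hF) n 1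
end

section
/- Let t ≥ 1 be real and let z be a real number with t·|z| < 1. Define m_0(t) = 1 and, for n ≥ 1, m_n(t) = t^(2n) − (t/2)·∑_{k=1}^{n} (1/(2k−1))·binomial(2k,k)·(t−1)^k·t^(2(n−k)). Then 1 − 4(t−1)z² > 0, t²z² ≠ 1, and the series ∑_{n=0}^{∞} m_n(t)·z^(2n) converges with sum (t − 2 − t·√(1 − 4(t−1)z²)) / (2(t²z² − 1)). -/
/-- The `2n`-th moment of the free binomial distribution with parameter `t`. -/
noncomputable def mfb (t : ℝ) (n : ℕ) : ℝ :=
  if n = 0 then 1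
  else t ^ (2 * n) - (t / 2) * ∑ k ∈ Finset.Icc 1 n,
    (1 / (2 * (k : ℝ) - 1)) * (Nat.choose (2 * k) k : ℝ) * (t - 1) ^ k * t ^ (2 * (n - k))

/-- The generalized binomial coefficients of `1 / 2` in terms of central binomial coefficients. -/
theorem choose_half_mul_neg_four_pow (k : ℕ) :
    Ring.choose (1 / 2 : ℝ) k * (-4) ^ k =
      -((1 / (2 * (k : ℝ) - 1)) * (Nat.choose (2 * k) k : ℝ)) := by
  have odd_ne_zero (j : ℕ) : 2 * (j : ℝ) - 1 ≠ 0 := by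
    intro h
    have : (2 * j : ℝ) = 1 := by linarith
    norm_cast at this
    omega
  induction k with
  | zero => simp
  | succ k ih =>
    have hchoose : Ring.choose (1 / 2 : ℝ) (k + 1) * (k + 1) =
        Ring.choose (1 / 2 : ℝ) k * (1 / 2 - k) := by
      have h := Ring.choose_smul_choose (1 / 2 : ℝ) (Nat.le_succ k)
      simp [Nat.choose_succ_self_right] at h
      linarith
    have hcentral : ((k : ℝ) + 1) * (Nat.choose (2 * (k + 1)) (k + 1) : ℝ) =
        2 * (2 * k + 1) * (Nat.choose (2 * k) k : ℝ) := by
      exact_mod_cast Nat.succ_mul_centralBinom_succ k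
    have hk : (k : ℝ) + 1 ≠ 0 := by positivity
    have hk' : 2 * (k : ℝ) + 1 ≠ 0 := by positivity
    have hodd := odd_ne_zero k
    have hsucc : 2 * ((k + 1 : ℕ) : ℝ) - 1 = 2 * k + 1 := by push_cast; ring
    rw [hsucc]
    apply mul_right_cancel₀ hk
    calc Ring.choose (1 / 2 : ℝ) (k + 1) * (-4) ^ (k + 1) * (k + 1)
        = (Ring.choose (1 / 2 : ℝ) (k + 1) * (k + 1)) * (-4) ^ (k + 1) := by ring
      _ = (Ring.choose (1 / 2 : ℝ) k * (-4) ^ k) * (2 * (2 * k - 1)) := by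
        rw [hchoose]; ring
      _ = -(2 * (Nat.choose (2 * k) k : ℝ)) := by
        rw [ih]; field_simp
      _ = -(1 / (2 * (k : ℝ) + 1) *
            (((k : ℝ) + 1) * (Nat.choose (2 * (k + 1)) (k + 1) : ℝ))) := by
        rw [hcentral]; field_simp
      _ = _ := by ring

/-- The Taylor expansion of `-√(1 - 4 * y)` at `0`, which converges absolutely. -/
theorem hasSum_neg_sqrt_one_sub_four_mul {y : ℝ} (hy : |4 * y| < 1) :
    HasSum (fun k : ℕ => (1 / (2 * (k : ℝ) - 1)) * (Nat.choose (2 * k) k : ℝ) * y ^ k)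
      (-Real.sqrt (1 - 4 * y)) ∧
    Summable (fun k : ℕ => ‖(1 / (2 * (k : ℝ) - 1)) * (Nat.choose (2 * k) k : ℝ) * y ^ k‖) := by
  have hterm (k : ℕ) : (1 / (2 * (k : ℝ) - 1)) * (Nat.choose (2 * k) k : ℝ) * y ^ k =
      -(binomialSeries ℝ (1 / 2 : ℝ) k fun _ => -4 * y) := by
    rw [binomialSeries_apply, List.ofFn_const, List.prod_replicate, smul_eq_mul, mul_pow,
      ← mul_assoc, choose_half_mul_neg_four_pow]
    ring
  have hball : -4 * y ∈ Metric.eball (0 : ℝ) 1 := by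
    rw [← ENNReal.ofReal_one, Metric.eball_ofReal]
    simpa [abs_mul] using hy
  simp_rw [hterm, norm_neg]
  constructor
  · have h := (Real.one_add_rpow_hasFPowerSeriesOnBall_zero (a := 1 / 2)).hasSum hball
    rw [zero_add, ← Real.sqrt_eq_rpow, show 1 + -4 * y = 1 - 4 * y by ring] at h
    exact h.neg
  · exact FormalMultilinearSeries.summable_norm_apply _
      (Metric.eball_subset_eball binomialSeries_radius_ge_one hball)

/-- The moments of the free binomial distribution, with the sum started at `k = 0`. -/
theorem mfb_eq_sum_range (t : ℝ) (n : ℕ) :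
    mfb t n = (1 - t / 2) * t ^ (2 * n) - (t / 2) * ∑ k ∈ Finset.range (n + 1),
      (1 / (2 * (k : ℝ) - 1)) * (Nat.choose (2 * k) k : ℝ) * (t - 1) ^ k * t ^ (2 * (n - k)) := by
  have hIcc : Finset.range (n + 1) = insert 0 (Finset.Icc 1 n) := by
    ext k
    simp only [Finset.mem_range, Finset.mem_insert, Finset.mem_Icc]
    omega
  rw [hIcc, Finset.sum_insert (by simp)]
  rcases eq_or_ne n 0 with rfl | hn
  · simp [mfb]
  · rw [mfb, if_neg hn]
    simp
    ring

theorem stmt7 (t z : ℝ) (ht : 1 ≤ t) (hz : t * |z| < 1) :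
    0 < 1 - 4 * (t - 1) * z ^ 2 ∧ t ^ 2 * z ^ 2 ≠ 1 ∧
    HasSum (fun n : ℕ => mfb t n * z ^ (2 * n))
      ((t - 2 - t * Real.sqrt (1 - 4 * (t - 1) * z ^ 2)) / (2 * (t ^ 2 * z ^ 2 - 1))) := by
  have hu : t ^ 2 * z ^ 2 < 1 := by
    rw [← sq_abs z, ← mul_pow]
    exact pow_lt_one₀ (by positivity) hz two_ne_zero
  have hu₀ : 0 ≤ t ^ 2 * z ^ 2 := by positivity
  have hy : 4 * ((t - 1) * z ^ 2) < 1 := by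
    nlinarith [mul_nonneg (sq_nonneg (t - 2)) (sq_nonneg z)]
  have hy₀ : 0 ≤ (t - 1) * z ^ 2 := mul_nonneg (by linarith) (sq_nonneg z)
  refine ⟨by linarith, hu.ne, ?_⟩
  obtain ⟨hsqrt, hsqrt_norm⟩ :=
    hasSum_neg_sqrt_one_sub_four_mul (y := (t - 1) * z ^ 2) (by rwa [abs_of_nonneg (by positivity)])
  have hgeom := hasSum_geometric_of_lt_one hu₀ hu
  have hgeom_norm : Summable fun n : ℕ => ‖(t ^ 2 * z ^ 2) ^ n‖ :=
    summable_norm_geometric_of_norm_lt_one (by rwa [Real.norm_of_nonneg hu₀])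
  have hconv := hasSum_sum_range_mul_of_summable_norm hsqrt_norm hgeom_norm
  rw [hsqrt.tsum_eq, hgeom.tsum_eq] at hconv
  convert! (hgeom.mul_left (1 - t / 2)).sub (hconv.mul_left (t / 2)) using 1
  · ext n
    rw [mfb_eq_sum_range, sub_mul, mul_assoc (t / 2), Finset.sum_mul]
    congr 1
    · rw [mul_pow, ← pow_mul, ← pow_mul, mul_assoc]
    · congr 1
      refine Finset.sum_congr rfl fun k hk => ?_
      have hkn : n = k + (n - k) := by
        have := Finset.mem_range.mp hk
        omega
      rw [show z ^ (2 * n) = z ^ (2 * k) * z ^ (2 * (n - k)) by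
        rw [← pow_add, ← mul_add, ← hkn]]
      simp only [mul_pow, ← pow_mul]
      ring
  · have hden : 1 - t ^ 2 * z ^ 2 ≠ 0 := by linarith
    rw [show 1 - 4 * (t - 1) * z ^ 2 = 1 - 4 * ((t - 1) * z ^ 2) by ring,
      ← neg_sub 1 (t ^ 2 * z ^ 2)]
    generalize 1 - t ^ 2 * z ^ 2 = d at hden ⊢
    generalize Real.sqrt (1 - 4 * ((t - 1) * z ^ 2)) = s
    field_simp
    ring
end

section
/- Fix k ≥ 2. For ℓ ≥ 1 and p ≥ 0 let c_ℓ(p) be the number of non-crossing pair partitions of {1,…,p} in which every pair has depth at most ℓ−1 (so c_ℓ(0) = 1 and c_ℓ(p) = 0 for odd p), and for p, q ≥ 0 let D_ℓ(p,q) = ∑_{(p_1,…,p_q)} ∏_{i=1}^{q} c_ℓ(p_i − 1), the sum being over all ordered tuples of odd positive integers p_1,…,p_q with p_1 + ⋯ + p_q = p (so D_ℓ(0,0) = 1 and D_ℓ(p,0) = 0 for p > 0). Let A_k(n) denote the cardinality of TCNC_2^{k,k}(2n). Then for every n ≥ 1: A_k(n) = 2·∑_{i=n}^{2n−1} binomial(2n−1,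 i)·D_{k−1}(i, 2n−i) − ∑_{j=1}^{n−2} A_k(j) · ∑_{p=n−j−1}^{2(n−j)−1} binomial(2(n−j)−1, p)·[ D_{k−1}(p+1, 2(n−j)−p−1) − D_{k−1}(p, 2(n−j)−p) ]. -/
/-- The relative depth of a pair `P` of a given color (`S` = pairs of the same
color as `P`, `O` = pairs of the opposite color): the number of pairs `Q ∈ S`
with (`Q = P` or `P` nested inside `Q`) such that `Q` is nested inside every
pair of the opposite color in which `P` is nested. -/
noncomputable def relDepth (S O : Finset (Finset ℕ)) (P : Finset ℕ) : ℕ :=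
  Set.ncard {Q : Finset ℕ | Q ∈ S ∧ (Q = P ∨ Nested P Q) ∧
    ∀ R ∈ O, Nested P R → Nested Q R}

/-- A two-colored non-crossing pair partition of `{1, …, 2n}`, given as the pair
`c = (blue pairs, red pairs)`, belonging to `TCNC_2^{k,ℓ}(2n)`: every blue pair
has relative depth at most `k − 1` and every red pair has relative depth at
most `ℓ − 1`. -/
def MemTCNC2 (k l n : ℕ) (c : Finset (Finset ℕ) × Finset (Finset ℕ)) : Prop :=
  Disjoint c.1 c.2 ∧ IsPairPartition (2 * n) (c.1 ∪ c.2) ∧ NonCrossing (c.1 ∪ c.2) ∧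
  (∀ P ∈ c.1, relDepth c.1 c.2 P ≤ k - 1) ∧
  (∀ P ∈ c.2, relDepth c.2 c.1 P ≤ l - 1)

/-- `c_ℓ(p)`: the number of non-crossing pair partitions of `{1, …, p}` in which
every pair has depth at most `ℓ − 1`. -/
noncomputable def cnum (l p : ℕ) : ℕ :=
  Set.ncard {π : Finset (Finset ℕ) | IsPairPartition p π ∧ NonCrossing π ∧
    ∀ P ∈ π, pairDepth π P ≤ l - 1}

open Classical in
/-- `D_ℓ(p, q) = ∑_{(p_1,…,p_q)} ∏_i c_ℓ(p_i − 1)`, summing over ordered tuples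
of odd positive integers with `p_1 + ⋯ + p_q = p`. -/
noncomputable def Dnum (l p q : ℕ) : ℕ :=
  ∑ f ∈ Finset.univ.filter (fun f : Fin q → Fin (p + 1) =>
      (∀ i, Odd ((f i : ℕ))) ∧ ∑ i, ((f i : ℕ)) = p),
    ∏ i, cnum l ((f i : ℕ) - 1)

/-- `A_k(n)`: the cardinality of `TCNC_2^{k,k}(2n)`. -/
noncomputable def Anum (k n : ℕ) : ℕ :=
  Set.ncard {c : Finset (Finset ℕ) × Finset (Finset ℕ) | MemTCNC2 k k n c}

/-- A two-coloured plane forest (first tree of colour `c` with children `l`, then the remaining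
forest `r`) respects the relative depth bounds `K`, `L` inside a context in which the innermost
monochromatic chain consists of `b` blue (`true`) or `r` red (`false`) nodes. -/
def DepthBounded (K L : ℕ) : ℕ → ℕ → BinaryTree Bool → Prop
  | _, _, .nil => True
  | b, r, .node true s t => b < K ∧ DepthBounded K L (b + 1) 0 s ∧ DepthBounded K L b r t
  | b, r, .node false s t => r < L ∧ DepthBounded K L 0 (r + 1) s ∧ DepthBounded K L b r t

open Classical in
/-- The forests with `n` nodes satisfying `DepthBounded K L b r`. -/
noncomputable def boundedForests (K L : ℕ) (b r : ℕ) : ℕ → Finset (BinaryTree Bool)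
  | 0 => {.nil}
  | n + 1 => (Finset.HasAntidiagonal.antidiagonal n).attach.biUnion fun ij =>
      have := Finset.HasAntidiagonal.mem_antidiagonal.1 ij.2
      (if b < K then ((boundedForests K L (b + 1) 0 ij.1.1 ×ˢ boundedForests K L b r ij.1.2).image
        fun st => .node true st.1 st.2) else ∅) ∪
      (if r < L then ((boundedForests K L 0 (r + 1) ij.1.1 ×ˢ boundedForests K L b r ij.1.2).image
        fun st => .node false st.1 st.2) else ∅)
  termination_by n => n
  decreasing_by all_goals omega

theorem mem_boundedForests (K L : ℕ) (t : BinaryTree Bool) : ∀ (b r n : ℕ),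
    t ∈ boundedForests K L b r n ↔ t.numNodes = n ∧ DepthBounded K L b r t := by
  induction t with
  | nil =>
    intro b r n
    cases n with
    | zero => simp [boundedForests, DepthBounded]
    | succ n =>
      rw [boundedForests]
      simp only [Finset.mem_biUnion, Finset.mem_union]
      constructor
      · rintro ⟨ij, -, h | h⟩ <;> split_ifs at h <;> simp at h
      · simp
  | node c s t hs ht =>
    intro b r n
    cases n with
    | zero => simp [boundedForests]
    | succ n =>
      rw [boundedForests]
      simp only [Finset.mem_biUnion, Finset.mem_union]
      constructor
      · rintro ⟨⟨⟨i, j⟩, hij⟩, -, h | h⟩ <;> split_ifs at h <;>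
          simp only [Finset.mem_image, Finset.mem_product, Prod.exists, BinaryTree.node.injEq,
            Finset.notMem_empty] at h <;>
          obtain ⟨s', t', ⟨h1, h2⟩, rfl, rfl, rfl⟩ := h <;>
          rw [hs] at h1 <;> rw [ht] at h2 <;>
          rw [Finset.HasAntidiagonal.mem_antidiagonal] at hij <;>
          simp_all [DepthBounded]
      · rintro ⟨h1, h2⟩
        have hn : s.numNodes + t.numNodes = n := by simpa using h1
        refine ⟨⟨(s.numNodes, t.numNodes), by simp [hn]⟩, Finset.mem_attach _ _, ?_⟩
        cases c
        · obtain ⟨h3, h4, h5⟩ := h2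
          right
          simp [h3, hs, ht, h4, h5]
        · obtain ⟨h3, h4, h5⟩ := h2
          left
          simp [h3, hs, ht, h4, h5]

theorem card_boundedForests_succ (K L b r n : ℕ) :
    (boundedForests K L b r (n + 1)).card = ∑ ij ∈ Finset.HasAntidiagonal.antidiagonal n,
      ((if b < K then (boundedForests K L (b + 1) 0 ij.1).card else 0) +
        (if r < L then (boundedForests K L 0 (r + 1) ij.1).card else 0)) *
        (boundedForests K L b r ij.2).card := by
  classical
  have hinj : ∀ c : Bool, Function.Injective
      fun st : BinaryTree Bool × BinaryTree Bool => BinaryTree.node c st.1 st.2 := by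
    rintro c ⟨s, t⟩ ⟨s', t'⟩ h
    simpa using h
  rw [boundedForests, Finset.card_biUnion]
  · rw [← Finset.sum_attach (Finset.HasAntidiagonal.antidiagonal n)]
    refine Finset.sum_congr rfl fun ij _ => ?_
    rw [Finset.card_union_of_disjoint, add_mul]
    · congr 1 <;> split_ifs <;> simp [Finset.card_image_of_injective _ (hinj _)]
    · rw [Finset.disjoint_left]
      intro t h1 h2
      split_ifs at h1 h2 <;> simp at h1 h2
      obtain ⟨a, b, -, rfl⟩ := h1
      simp at h2
  · rintro ⟨⟨i, j⟩, hij⟩ - ⟨⟨i', j'⟩, hij'⟩ - hne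
    rw [Function.onFun, Finset.disjoint_left]
    intro t h1 h2
    apply hne
    rw [Finset.HasAntidiagonal.mem_antidiagonal] at hij hij'
    simp only [Finset.mem_union] at h1 h2
    rcases h1 with h1 | h1 <;> rcases h2 with h2 | h2 <;> split_ifs at h1 h2 <;>
      simp only [Finset.mem_image, Finset.mem_product, Prod.exists, mem_boundedForests,
        Finset.notMem_empty] at h1 h2 <;>
      obtain ⟨s, t, h, rfl⟩ := h1 <;> obtain ⟨s', t', h', he⟩ := h2 <;>
      rw [BinaryTree.node.injEq] at he <;> obtain ⟨h3, rfl, rfl⟩ := he <;> grind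

theorem card_boundedForests_zero (K L b r : ℕ) : (boundedForests K L b r 0).card = 1 := by
  simp [boundedForests]

theorem card_boundedForests_comm (K L n : ℕ) : ∀ b r : ℕ,
    (boundedForests K L b r n).card = (boundedForests L K r b n).card := by
  induction n using Nat.strong_induction_on with
  | _ n ih =>
    intro b r
    cases n with
    | zero => simp [card_boundedForests_zero]
    | succ n =>
      simp only [card_boundedForests_succ]
      refine Finset.sum_congr rfl fun ij hij => ?_
      rw [Finset.HasAntidiagonal.mem_antidiagonal] at hij
      rw [ih ij.1 (by omega) (b + 1), ih ij.1 (by omega) 0, ih ij.2 (by omega), add_comm]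

theorem card_boundedForests_shift (K n : ℕ) : ∀ b : ℕ,
    (boundedForests (K + 1) 0 (b + 1) 0 n).card = (boundedForests K 0 b 0 n).card := by
  induction n using Nat.strong_induction_on with
  | _ n ih =>
    intro b
    cases n with
    | zero => simp [card_boundedForests_zero]
    | succ n =>
      simp only [card_boundedForests_succ]
      refine Finset.sum_congr rfl fun ij hij => ?_
      rw [Finset.HasAntidiagonal.mem_antidiagonal] at hij
      rw [ih ij.1 (by omega) (b + 1), ih ij.2 (by omega)]
      simp

open PowerSeries in
/-- The generating function of the forests satisfying `DepthBounded K L b r`. -/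
noncomputable def forestSeries (K L b r : ℕ) : PowerSeries ℚ :=
  mk fun n => ((boundedForests K L b r n).card : ℚ)

open PowerSeries in
theorem forestSeries_eq (K L b r : ℕ) :
    forestSeries K L b r = 1 + X * (((if b < K then forestSeries K L (b + 1) 0 else 0) +
      (if r < L then forestSeries K L 0 (r + 1) else 0)) * forestSeries K L b r) := by
  ext n
  cases n with
  | zero => simp [forestSeries, card_boundedForests_zero]
  | succ n =>
    rw [map_add, coeff_succ_X_mul, coeff_mul, forestSeries, coeff_mk, card_boundedForests_succ]
    simp only [coeff_one, Nat.succ_ne_zero, if_false, zero_add]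
    push_cast
    refine Finset.sum_congr rfl fun ij _ => ?_
    congr 1
    · rw [map_add]
      split_ifs <;> simp [forestSeries]
    · simp

theorem forestSeries_comm (K L b r : ℕ) : forestSeries K L b r = forestSeries L K r b := by
  ext n
  simp [forestSeries, card_boundedForests_comm K L n b r]

open PowerSeries in
/-- The generating function of the numbers `cnum l p`. -/
noncomputable def depthSeries (l : ℕ) : PowerSeries ℚ :=
  expand 2 two_ne_zero (forestSeries (l - 1) 0 0 0)

open PowerSeries in
theorem depthSeries_one : depthSeries 1 = 1 := by
  have h := forestSeries_eq 0 0 0 0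
  simp only [lt_irrefl, if_false, add_zero, zero_mul, mul_zero] at h
  rw [depthSeries, h, map_one]

open PowerSeries in
theorem depthSeries_succ (l : ℕ) :
    depthSeries (l + 2) = 1 + X ^ 2 * (depthSeries (l + 1) * depthSeries (l + 2)) := by
  have h := forestSeries_eq (l + 1) 0 0 0
  have h2 : forestSeries (l + 1) 0 1 0 = forestSeries l 0 0 0 := by
    ext n
    simp [forestSeries, card_boundedForests_shift l n 0]
  simp only [lt_irrefl, if_false, add_zero, Nat.succ_pos, if_true, zero_add, h2] at h
  have h3 := congrArg (expand 2 two_ne_zero) h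
  simpa [depthSeries] using h3

open PowerSeries in
/-- A system of equations over power series which is a contraction for the `X`-adic topology
determines its solutions. -/
theorem chain_system_unique (K : ℕ) (z : PowerSeries ℚ) (hz : X ∣ z) (e f : ℕ → PowerSeries ℚ)
    (he : ∀ d, 1 ≤ d → d ≤ K → e d = 1 + z * (((if d < K then e (d + 1) else 0) + e 1) * e d))
    (hf : ∀ d, 1 ≤ d → d ≤ K → f d = 1 + z * (((if d < K then f (d + 1) else 0) + f 1) * f d))
    (d : ℕ) (hd : 1 ≤ d) (hdK : d ≤ K) : e d = f d := by
  have key : ∀ n d, 1 ≤ d → d ≤ K → (X : PowerSeries ℚ) ^ n ∣ e d - f d := by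
    intro n
    induction n with
    | zero => simp
    | succ n ih =>
      intro d hd hdK
      obtain ⟨q, rfl⟩ := hz
      have h1 := ih 1 le_rfl (hd.trans hdK)
      have h2 := ih d hd hdK
      have h3 : (X : PowerSeries ℚ) ^ n ∣
          (if d < K then e (d + 1) else 0) - (if d < K then f (d + 1) else 0) := by
        split_ifs with h
        · exact ih (d + 1) (by omega) (by omega)
        · simp
      rw [he d hd hdK, hf d hd hdK]
      set e' := if d < K then e (d + 1) else 0
      set f' := if d < K then f (d + 1) else 0
      have : 1 + X * q * ((e' + e 1) * e d) - (1 + X * q * ((f' + f 1) * f d)) =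
          X * (q * (((e' - f') + (e 1 - f 1)) * e d + (f' + f 1) * (e d - f d))) := by ring
      rw [this, pow_succ']
      exact mul_dvd_mul_left _ (Dvd.dvd.mul_left (dvd_add ((dvd_add h3 h1).mul_right _)
        (h2.mul_left _)) _)
  rw [← sub_eq_zero]
  ext n
  have := X_pow_dvd_iff.1 (key (n + 1) d hd hdK) n (by omega)
  simpa using this

open PowerSeries in
/-- The generating function of `Anum`, evaluated at `(X / φ)²` where `φ = 1 + X² C(X²)`. -/
theorem subst_forestSeries (K : ℕ) (hK : 1 ≤ K) (φ z : PowerSeries ℚ)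
    (hφ : φ = 1 + X ^ 2 * depthSeries K) (hz : z * φ ^ 2 = X ^ 2) (hzX : X ∣ z) :
    (2 - φ) * (forestSeries K K 0 0).subst z = φ := by
  have hs : HasSubst z := HasSubst.of_constantCoeff_zero' (X_dvd_iff.1 hzX)
  have hφ0 : φ ≠ 0 := by
    rintro rfl
    have := congrArg (coeff 0) hφ
    simp at this
  have hse (b r : ℕ) : (forestSeries K K b r).subst z =
      1 + z * (((if b < K then (forestSeries K K (b + 1) 0).subst z else 0) +
      (if r < K then (forestSeries K K 0 (r + 1)).subst z else 0)) *
        (forestSeries K K b r).subst z) := by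
    have h := congrArg (substAlgHom hs) (forestSeries_eq K K b r)
    simp only [map_add, map_mul, map_one, substAlgHom_X, apply_ite (substAlgHom hs),
      map_zero] at h
    simpa only [coe_substAlgHom] using h
  have hsol := chain_system_unique K z hzX (fun d => (forestSeries K K d 0).subst z)
    (fun d => φ * depthSeries (K + 1 - d)) ?_ ?_ 1 le_rfl hK
  · have h := hse 0 0
    simp only [Nat.lt_of_lt_of_le Nat.zero_lt_one hK, if_true, zero_add,
      forestSeries_comm K K 0 1] at h
    simp only [Nat.add_sub_cancel] at hsol
    rw [hsol] at h
    generalize (forestSeries K K 0 0).subst z = a at h ⊢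
    have h1 : φ * (z * (φ * depthSeries K)) = φ - 1 := by
      rw [hφ] at *
      linear_combination depthSeries K * hz
    linear_combination φ * h + 2 * a * h1
  · intro d hd hdK
    have h := hse d 0
    rw [forestSeries_comm K K 0 1] at h
    simpa [Nat.lt_of_lt_of_le Nat.zero_lt_one hK] using h
  · intro d hd hdK
    have h1 : φ * (z * (φ * depthSeries K)) = φ - 1 := by
      rw [hφ] at *
      linear_combination depthSeries K * hz
    simp only [Nat.add_sub_cancel]
    split_ifs with h
    · obtain ⟨m, rfl⟩ := Nat.exists_eq_add_of_lt h
      have e1 : d + m + 1 + 1 - d = m + 2 := by omega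
      have e2 : d + m + 1 + 1 - (d + 1) = m + 1 := by omega
      rw [e1, e2]
      have h2 := depthSeries_succ m
      linear_combination h2 - depthSeries (m + 2) * h1 -
        depthSeries (m + 1) * depthSeries (m + 2) * hz
    · have : d = K := by omega
      subst this
      have e1 : d + 1 - d = 1 := by omega
      rw [e1, depthSeries_one]
      linear_combination - h1

/-- The coloured pairs drawn by a two-coloured plane forest on the points `x + 1, x + 2, …`:
each node is a pair, enclosing the pairs of its children. -/
def forestPairs : ℕ → BinaryTree Bool → Bool → Finset (Finset ℕ)
  | _, .nil, _ => ∅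
  | x, .node c s t, c' => (if c' = c then {{x + 1, x + 2 * s.numNodes + 2}} else ∅) ∪
      (forestPairs (x + 1) s c' ∪ forestPairs (x + 2 * s.numNodes + 2) t c')

/-- The family `f` of coloured pairs is a two-coloured non-crossing pair partition of
`{x + 1, …, y}`. -/
structure IsColoredNC (x y : ℕ) (f : Bool → Finset (Finset ℕ)) : Prop where
  card_eq : ∀ c, ∀ P ∈ f c, P.card = 2
  cover : ∀ i, (∃ c, ∃ P ∈ f c, i ∈ P) ↔ x < i ∧ i ≤ y
  unique : ∀ c c' P Q i, P ∈ f c → Q ∈ f c' → i ∈ P → i ∈ Q → c = c' ∧ P = Q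
  noncrossing : ∀ c c' P Q, P ∈ f c → Q ∈ f c' → ∀ i ∈ P, ∀ j ∈ Q, ∀ k ∈ P, ∀ l ∈ Q,
    i < j → j < k → k < l → False

theorem IsColoredNC.mem_Ioc {x y : ℕ} {f : Bool → Finset (Finset ℕ)} (h : IsColoredNC x y f)
    {c : Bool} {P : Finset ℕ} (hP : P ∈ f c) {i : ℕ} (hi : i ∈ P) : x < i ∧ i ≤ y :=
  (h.cover i).1 ⟨c, P, hP, hi⟩

theorem IsColoredNC.nonempty {x y : ℕ} {f : Bool → Finset (Finset ℕ)} (h : IsColoredNC x y f)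
    {c : Bool} {P : Finset ℕ} (hP : P ∈ f c) : P.Nonempty := by
  rw [← Finset.card_pos, h.card_eq c P hP]
  norm_num

theorem mem_forestPairs_node {x : ℕ} {c c' : Bool} {s t : BinaryTree Bool} {P : Finset ℕ} :
    P ∈ forestPairs x (.node c s t) c' ↔
      (c' = c ∧ P = {x + 1, x + 2 * s.numNodes + 2}) ∨ P ∈ forestPairs (x + 1) s c' ∨
        P ∈ forestPairs (x + 2 * s.numNodes + 2) t c' := by
  rw [forestPairs, Finset.mem_union, Finset.mem_union]
  split_ifs with h <;> simp [h]

theorem isColoredNC_forestPairs (t : BinaryTree Bool) :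
    ∀ x, IsColoredNC x (x + 2 * t.numNodes) (forestPairs x t) := by
  induction t with
  | nil =>
    intro x
    constructor <;> simp [forestPairs]
  | node c s t hs ht =>
    intro x
    have h1 := hs (x + 1)
    have h2 := ht (x + 2 * s.numNodes + 2)
    have m1 : ∀ c P, P ∈ forestPairs (x + 1) s c → ∀ i ∈ P, x + 1 < i ∧
      i < x + 2 * s.numNodes + 2 := fun c P hP i hi => by
        have := h1.mem_Ioc hP hi
        omega
    have m2 : ∀ c P, P ∈ forestPairs (x + 2 * s.numNodes + 2) t c → ∀ i ∈ P,
      x + 2 * s.numNodes + 2 < i := fun c P hP i hi => (h2.mem_Ioc hP hi).1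
    constructor
    · intro c' P hP
      rcases mem_forestPairs_node.1 hP with ⟨-, rfl⟩ | hP | hP
      · exact Finset.card_pair (by omega)
      · exact h1.card_eq _ _ hP
      · exact h2.card_eq _ _ hP
    · intro i
      have c1 := h1.cover i
      have c2 := h2.cover i
      simp only [BinaryTree.numNodes]
      constructor
      · rintro ⟨c', P, hP, hi⟩
        rcases mem_forestPairs_node.1 hP with ⟨-, rfl⟩ | hP | hP
        · simp only [Finset.mem_insert, Finset.mem_singleton] at hi
          omega
        · have := c1.1 ⟨_, _, hP, hi⟩
          omega
        · have := c2.1 ⟨_, _, hP, hi⟩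
          omega
      · intro hi
        by_cases e : i = x + 1 ∨ i = x + 2 * s.numNodes + 2
        · exact ⟨c, _, mem_forestPairs_node.2 (.inl ⟨rfl, rfl⟩), by simpa using e⟩
        · by_cases hlt : i < x + 2 * s.numNodes + 2
          · obtain ⟨c', P, hP, hiP⟩ := c1.2 (by omega)
            exact ⟨c', P, mem_forestPairs_node.2 (.inr (.inl hP)), hiP⟩
          · obtain ⟨c', P, hP, hiP⟩ := c2.2 (by omega)
            exact ⟨c', P, mem_forestPairs_node.2 (.inr (.inr hP)), hiP⟩
    · intro c1 c2 P Q i hP hQ hiP hiQ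
      rcases mem_forestPairs_node.1 hP with ⟨rfl, rfl⟩ | hP' | hP' <;>
        rcases mem_forestPairs_node.1 hQ with ⟨rfl, rfl⟩ | hQ' | hQ' <;>
        try simp only [Finset.mem_insert, Finset.mem_singleton] at hiP hiQ
      · exact ⟨rfl, rfl⟩
      · have := m1 _ _ hQ' i hiQ
        omega
      · have := m2 _ _ hQ' i hiQ
        omega
      · have := m1 _ _ hP' i hiP
        omega
      · exact h1.unique _ _ _ _ i hP' hQ' hiP hiQ
      · have := m1 _ _ hP' i hiP
        have := m2 _ _ hQ' i hiQ
        omega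
      · have := m2 _ _ hP' i hiP
        omega
      · have := m1 _ _ hQ' i hiQ
        have := m2 _ _ hP' i hiP
        omega
      · exact h2.unique _ _ _ _ i hP' hQ' hiP hiQ
    · intro c1 c2 P Q hP hQ i hi j hj k hk l hl hij hjk hkl
      rcases mem_forestPairs_node.1 hP with ⟨rfl, rfl⟩ | hP' | hP' <;>
        rcases mem_forestPairs_node.1 hQ with ⟨rfl, rfl⟩ | hQ' | hQ' <;>
        try simp only [Finset.mem_insert, Finset.mem_singleton] at hi hj hk hl
      · omega
      · have := m1 _ _ hQ' _ hl
        omega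
      · have := m2 _ _ hQ' _ hj
        omega
      · have := m1 _ _ hP' _ hi
        have := m1 _ _ hP' _ hk
        omega
      · exact h1.noncrossing _ _ _ _ hP' hQ' i hi j hj k hk l hl hij hjk hkl
      · have := m1 _ _ hP' _ hk
        have := m2 _ _ hQ' _ hj
        omega
      · have := m2 _ _ hP' _ hi
        omega
      · have := m1 _ _ hQ' _ hj
        have := m2 _ _ hP' _ hi
        omega
      · exact h2.noncrossing _ _ _ _ hP' hQ' i hi j hj k hk l hl hij hjk hkl

theorem exists_forestPairs_eq (m : ℕ) : ∀ (x y : ℕ) (f : Bool → Finset (Finset ℕ)),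
    IsColoredNC x y f → y = x + m →
      ∃ t : BinaryTree Bool, y = x + 2 * t.numNodes ∧ f = forestPairs x t := by
  induction m using Nat.strong_induction_on with
  | _ m ih =>
    intro x y f h hy
    rcases Nat.eq_zero_or_pos m with rfl | hm
    · refine ⟨.nil, by simpa using hy, ?_⟩
      funext c
      rw [forestPairs, Finset.eq_empty_iff_forall_notMem]
      intro P hP
      obtain ⟨i, hi⟩ := h.nonempty hP
      have := h.mem_Ioc hP hi
      omega
    · obtain ⟨c, P, hP, hxP⟩ := (h.cover (x + 1)).2 (by omega)
      obtain ⟨e, hxe, hPe⟩ : ∃ e, x + 1 < e ∧ P = {x + 1, e} := by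
        obtain ⟨a, b, hab, rfl⟩ := Finset.card_eq_two.1 (h.card_eq c P hP)
        have ha := h.mem_Ioc hP (Finset.mem_insert_self a _)
        have hb := h.mem_Ioc hP (Finset.mem_insert_of_mem (Finset.mem_singleton_self b))
        rcases Finset.mem_insert.1 hxP with rfl | hx
        · exact ⟨b, by omega, rfl⟩
        · rw [Finset.mem_singleton] at hx
          subst hx
          exact ⟨a, by omega, Finset.pair_comm _ _⟩
      subst hPe
      have heP : e ∈ ({x + 1, e} : Finset ℕ) := by simp
      have hey := (h.mem_Ioc hP heP).2
      have hsplit : ∀ c' Q, Q ∈ f c' → (c' = c ∧ Q = {x + 1, e}) ∨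
          (∀ i ∈ Q, x + 1 < i ∧ i < e) ∨ (∀ i ∈ Q, e < i) := by
        intro c' Q hQ
        by_cases hx : x + 1 ∈ Q
        · exact .inl (h.unique _ _ _ _ _ hQ hP hx hxP)
        by_cases he : e ∈ Q
        · exact .inl (h.unique _ _ _ _ _ hQ hP he heP)
        have hne (i : ℕ) (hi : i ∈ Q) : x + 1 < i ∧ i ≠ e := by
          have := (h.mem_Ioc hQ hi).1
          have h3 : i ≠ x + 1 := by
            rintro rfl
            exact hx hi
          have h4 : i ≠ e := by
            rintro rfl
            exact he hi
          omega
        right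
        by_contra! hcon
        obtain ⟨⟨i, hi, hi'⟩, j, hj, hj'⟩ := hcon
        have hi2 := hne i hi
        have hj2 := hne j hj
        have := hi' hi2.1
        exact h.noncrossing _ _ _ _ hP hQ (x + 1) hxP j hj e heP i hi hj2.1 (by omega) (by omega)
      have hrestrict : ∀ (p : ℕ → Prop) [DecidablePred p] (u v : ℕ),
          (∀ i, x < i → i ≤ y → (p i ↔ u < i ∧ i ≤ v)) → x ≤ u → v ≤ y →
          (∀ c' Q, Q ∈ f c' → (∃ i ∈ Q, p i) → ∀ i ∈ Q, p i) →
          IsColoredNC u v fun c' => (f c').filter fun Q => ∀ i ∈ Q, p i := by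
        intro p _ u v hp hu hv hall
        refine ⟨fun c' Q hQ => h.card_eq c' Q (Finset.mem_filter.1 hQ).1, fun i => ?_,
          fun c1 c2 Q1 Q2 i h1 h2 => h.unique c1 c2 Q1 Q2 i (Finset.mem_filter.1 h1).1
            (Finset.mem_filter.1 h2).1, fun c1 c2 Q1 Q2 h1 h2 => h.noncrossing c1 c2 Q1 Q2
            (Finset.mem_filter.1 h1).1 (Finset.mem_filter.1 h2).1⟩
        constructor
        · rintro ⟨c', Q, hQ, hi⟩
          rw [Finset.mem_filter] at hQ
          have := h.mem_Ioc hQ.1 hi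
          exact (hp i this.1 this.2).1 (hQ.2 i hi)
        · intro hi
          obtain ⟨c', Q, hQ, hiQ⟩ := (h.cover i).2 (by omega)
          exact ⟨c', Q, Finset.mem_filter.2 ⟨hQ, hall c' Q hQ ⟨i, hiQ,
            (hp i (by omega) (by omega)).2 hi⟩⟩, hiQ⟩
      have hf1 := hrestrict (fun i => x + 1 < i ∧ i < e) (x + 1) (e - 1) (by omega) (by omega)
        (by omega) (by
          rintro c' Q hQ ⟨i, hi, hi'⟩
          rcases hsplit c' Q hQ with ⟨-, rfl⟩ | h' | h'
          · simp only [Finset.mem_insert, Finset.mem_singleton] at hi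
            omega
          · exact h'
          · have := h' i hi
            omega)
      have hf2 := hrestrict (fun i => e < i) e y (by omega) (by omega) (by omega) (by
          rintro c' Q hQ ⟨i, hi, hi'⟩
          rcases hsplit c' Q hQ with ⟨-, rfl⟩ | h' | h'
          · simp only [Finset.mem_insert, Finset.mem_singleton] at hi
            omega
          · have := h' i hi
            omega
          · exact h')
      obtain ⟨s, hs, hs'⟩ := ih (e - 1 - (x + 1)) (by omega) _ _ _ hf1 (by omega)
      obtain ⟨t, ht, ht'⟩ := ih (y - e) (by omega) _ _ _ hf2 (by omega)
      have he : e = x + 2 * s.numNodes + 2 := by omega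
      refine ⟨.node c s t, by simp only [BinaryTree.numNodes]; omega, ?_⟩
      funext c'
      ext Q
      rw [mem_forestPairs_node, ← hs', ← he, ← ht', Finset.mem_filter, Finset.mem_filter]
      constructor
      · intro hQ
        rcases hsplit c' Q hQ with h' | h' | h'
        · exact .inl h'
        · exact .inr (.inl ⟨hQ, h'⟩)
        · exact .inr (.inr ⟨hQ, h'⟩)
      · rintro (⟨rfl, rfl⟩ | h' | h')
        · exact hP
        · exact h'.1
        · exact h'.1

theorem forestPairs_inner {x : ℕ} {c c' : Bool} {s t : BinaryTree Bool} :
    forestPairs (x + 1) s c' = (forestPairs x (.node c s t) c').filter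
      fun P => ∀ i ∈ P, x + 1 < i ∧ i ≤ x + 2 * s.numNodes + 1 := by
  have h1 := isColoredNC_forestPairs s (x + 1)
  have h2 := isColoredNC_forestPairs t (x + 2 * s.numNodes + 2)
  ext P
  rw [Finset.mem_filter, mem_forestPairs_node]
  constructor
  · intro hP
    refine ⟨.inr (.inl hP), fun i hi => ?_⟩
    have := h1.mem_Ioc hP hi
    omega
  · rintro ⟨⟨-, rfl⟩ | hP | hP, h⟩
    · have := h (x + 1) (by simp)
      omega
    · exact hP
    · obtain ⟨i, hi⟩ := h2.nonempty hP
      have := h2.mem_Ioc hP hi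
      have := h i hi
      omega

theorem forestPairs_rest {x : ℕ} {c c' : Bool} {s t : BinaryTree Bool} :
    forestPairs (x + 2 * s.numNodes + 2) t c' = (forestPairs x (.node c s t) c').filter
      fun P => ∀ i ∈ P, x + 2 * s.numNodes + 2 < i := by
  have h1 := isColoredNC_forestPairs s (x + 1)
  have h2 := isColoredNC_forestPairs t (x + 2 * s.numNodes + 2)
  ext P
  rw [Finset.mem_filter, mem_forestPairs_node]
  constructor
  · intro hP
    exact ⟨.inr (.inr hP), fun i hi => (h2.mem_Ioc hP hi).1⟩
  · rintro ⟨⟨-, rfl⟩ | hP | hP, h⟩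
    · have := h (x + 1) (by simp)
      omega
    · obtain ⟨i, hi⟩ := h1.nonempty hP
      have := h1.mem_Ioc hP hi
      have := h i hi
      omega
    · exact hP

theorem forestPairs_injective (t : BinaryTree Bool) : ∀ (x : ℕ) (t' : BinaryTree Bool),
    forestPairs x t = forestPairs x t' → t = t' := by
  have hroot (x : ℕ) (c : Bool) (s t : BinaryTree Bool) :
      {x + 1, x + 2 * s.numNodes + 2} ∈ forestPairs x (.node c s t) c :=
    mem_forestPairs_node.2 (.inl ⟨rfl, rfl⟩)
  induction t with
  | nil =>
    intro x t' h
    cases t' with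
    | nil => rfl
    | node c s t =>
      have := hroot x c s t
      rw [← h] at this
      simp [forestPairs] at this
  | node c s t hs ht =>
    intro x t' h
    cases t' with
    | nil =>
      have := hroot x c s t
      rw [h] at this
      simp [forestPairs] at this
    | node d s' t' =>
      have h1 := hroot x c s t
      rw [h] at h1
      obtain ⟨rfl, hP⟩ := (isColoredNC_forestPairs _ x).unique _ _ _ _ (x + 1) h1
        (hroot x d s' t') (by simp) (by simp)
      have hcard : s.numNodes = s'.numNodes := by
        have : x + 2 * s.numNodes + 2 ∈ ({x + 1, x + 2 * s'.numNodes + 2} : Finset ℕ) := by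
          rw [← hP]
          simp
        simp only [Finset.mem_insert, Finset.mem_singleton] at this
        omega
      have e1 := hs (x + 1) s' (by
        funext c'
        rw [forestPairs_inner (c := c) (t := t), forestPairs_inner (c := c) (t := t'), h, hcard])
      have e2 := ht (x + 2 * s.numNodes + 2) t' (by
        funext c'
        rw [forestPairs_rest (c := c), h, hcard, forestPairs_rest (c := c)])
      rw [e1, e2]

/-- The set counted by `relDepth`. -/
def sameColorChain (S O : Finset (Finset ℕ)) (P : Finset ℕ) : Set (Finset ℕ) :=
  {Q : Finset ℕ | Q ∈ S ∧ (Q = P ∨ Nested P Q) ∧ ∀ R ∈ O, Nested P R → Nested Q R}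

theorem finite_sameColorChain (S O : Finset (Finset ℕ)) (P : Finset ℕ) :
    (sameColorChain S O P).Finite :=
  S.finite_toSet.subset fun _ hQ => hQ.1

theorem ncard_sameColorChain (S O : Finset (Finset ℕ)) (P : Finset ℕ) :
    (sameColorChain S O P).ncard = relDepth S O P := rfl

open Classical in
/-- The relative depth of `P` when the whole configuration is moreover enclosed by a chain of `b`
pairs of the colour of `P`. -/
noncomputable def contextDepth (S O : Finset (Finset ℕ)) (b : ℕ) (P : Finset ℕ) : ℕ :=
  relDepth S O P + if ∃ R ∈ O, Nested P R then 0 else b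

theorem contextDepth_zero (S O : Finset (Finset ℕ)) (P : Finset ℕ) :
    contextDepth S O 0 P = relDepth S O P := by
  simp [contextDepth]

section Node

variable {x : ℕ} {c : Bool} {s t : BinaryTree Bool}

theorem forestPairs_inner_bounds {c' : Bool} {P : Finset ℕ} (hP : P ∈ forestPairs (x + 1) s c')
    {i : ℕ} (hi : i ∈ P) : x + 1 < i ∧ i < x + 2 * s.numNodes + 2 := by
  have := (isColoredNC_forestPairs s (x + 1)).mem_Ioc hP hi
  omega

theorem forestPairs_rest_bounds {c' : Bool} {P : Finset ℕ}
    (hP : P ∈ forestPairs (x + 2 * s.numNodes + 2) t c') {i : ℕ} (hi : i ∈ P) :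
    x + 2 * s.numNodes + 2 < i :=
  ((isColoredNC_forestPairs t _).mem_Ioc hP hi).1

theorem not_nested_root {c' : Bool} {R : Finset ℕ} (hR : R ∈ forestPairs x (.node c s t) c') :
    ¬ Nested {x + 1, x + 2 * s.numNodes + 2} R := by
  rintro ⟨a, ha, b, -, h⟩
  have := h (x + 1) (by simp)
  have := (isColoredNC_forestPairs _ x).mem_Ioc hR ha
  omega

theorem nested_inner_root {c' : Bool} {P : Finset ℕ} (hP : P ∈ forestPairs (x + 1) s c') :
    Nested P {x + 1, x + 2 * s.numNodes + 2} :=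
  ⟨x + 1, by simp, x + 2 * s.numNodes + 2, by simp, fun _ hi => forestPairs_inner_bounds hP hi⟩

theorem nested_inner_iff {c₁ c₂ : Bool} {P R : Finset ℕ} (hP : P ∈ forestPairs (x + 1) s c₁) :
    (R ∈ forestPairs x (.node c s t) c₂ ∧ Nested P R) ↔
      (c₂ = c ∧ R = {x + 1, x + 2 * s.numNodes + 2}) ∨
        (R ∈ forestPairs (x + 1) s c₂ ∧ Nested P R) := by
  rw [mem_forestPairs_node]
  constructor
  · rintro ⟨h | h | h, hn⟩
    · exact .inl h
    · exact .inr ⟨h, hn⟩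
    · exfalso
      obtain ⟨a, ha, b, -, hab⟩ := hn
      obtain ⟨i, hi⟩ := (isColoredNC_forestPairs s _).nonempty hP
      have := hab i hi
      have := forestPairs_inner_bounds hP hi
      have := forestPairs_rest_bounds h ha
      omega
  · rintro (⟨rfl, rfl⟩ | ⟨h, hn⟩)
    · exact ⟨.inl ⟨rfl, rfl⟩, nested_inner_root hP⟩
    · exact ⟨.inr (.inl h), hn⟩

theorem nested_rest_iff {c₁ c₂ : Bool} {P R : Finset ℕ}
    (hP : P ∈ forestPairs (x + 2 * s.numNodes + 2) t c₁) :
    (R ∈ forestPairs x (.node c s t) c₂ ∧ Nested P R) ↔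
      (R ∈ forestPairs (x + 2 * s.numNodes + 2) t c₂ ∧ Nested P R) := by
  rw [mem_forestPairs_node]
  constructor
  · rintro ⟨h | h | h, hn⟩
    · exfalso
      obtain ⟨-, rfl⟩ := h
      obtain ⟨a, -, b, hb, hab⟩ := hn
      obtain ⟨i, hi⟩ := (isColoredNC_forestPairs t _).nonempty hP
      have := hab i hi
      have := forestPairs_rest_bounds hP hi
      simp only [Finset.mem_insert, Finset.mem_singleton] at hb
      omega
    · exfalso
      obtain ⟨a, -, b, hb, hab⟩ := hn
      obtain ⟨i, hi⟩ := (isColoredNC_forestPairs t _).nonempty hP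
      have := hab i hi
      have := forestPairs_rest_bounds hP hi
      have := forestPairs_inner_bounds h hb
      omega
    · exact ⟨h, hn⟩
  · rintro ⟨h, hn⟩
    exact ⟨.inr (.inr h), hn⟩

theorem contextDepth_root (b : ℕ) :
    contextDepth (forestPairs x (.node c s t) c) (forestPairs x (.node c s t) !c) b
      {x + 1, x + 2 * s.numNodes + 2} = b + 1 := by
  have hset : sameColorChain (forestPairs x (.node c s t) c) (forestPairs x (.node c s t) !c)
      {x + 1, x + 2 * s.numNodes + 2} = {{x + 1, x + 2 * s.numNodes + 2}} := by
    ext Q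
    rw [Set.mem_singleton_iff]
    constructor
    · rintro ⟨hQ, h | h, -⟩
      · exact h
      · exact absurd h (not_nested_root hQ)
    · rintro rfl
      exact ⟨mem_forestPairs_node.2 (.inl ⟨rfl, rfl⟩), .inl rfl,
        fun R hR h => absurd h (not_nested_root hR)⟩
  rw [contextDepth, ← ncard_sameColorChain, hset, Set.ncard_singleton, if_neg, add_comm]
  rintro ⟨R, hR, h⟩
  exact not_nested_root hR h

theorem contextDepth_rest (b : ℕ) {c' : Bool} {P : Finset ℕ}
    (hP : P ∈ forestPairs (x + 2 * s.numNodes + 2) t c') :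
    contextDepth (forestPairs x (.node c s t) c') (forestPairs x (.node c s t) !c') b P =
      contextDepth (forestPairs (x + 2 * s.numNodes + 2) t c')
        (forestPairs (x + 2 * s.numNodes + 2) t !c') b P := by
  have hO (p : Finset ℕ → Prop) :
      (∀ R ∈ forestPairs x (.node c s t) !c', Nested P R → p R) ↔
        ∀ R ∈ forestPairs (x + 2 * s.numNodes + 2) t !c', Nested P R → p R := by
    constructor
    · intro h R hR hn
      have := (nested_rest_iff (c := c) hP).2 ⟨hR, hn⟩
      exact h R this.1 this.2
    · intro h R hR hn
      have := (nested_rest_iff hP).1 ⟨hR, hn⟩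
      exact h R this.1 this.2
  have hset : sameColorChain (forestPairs x (.node c s t) c') (forestPairs x (.node c s t) !c') P =
      sameColorChain (forestPairs (x + 2 * s.numNodes + 2) t c')
        (forestPairs (x + 2 * s.numNodes + 2) t !c') P := by
    ext Q
    constructor
    · rintro ⟨hQ, h, h'⟩
      rw [hO] at h'
      rcases h with rfl | h
      · exact ⟨hP, .inl rfl, h'⟩
      · exact ⟨((nested_rest_iff hP).1 ⟨hQ, h⟩).1, .inr h, h'⟩
    · rintro ⟨hQ, h, h'⟩
      rw [← hO] at h'
      exact ⟨mem_forestPairs_node.2 (.inr (.inr hQ)), h, h'⟩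
  rw [contextDepth, contextDepth, ← ncard_sameColorChain, hset, ncard_sameColorChain]
  have hex : (∃ R ∈ forestPairs x (.node c s t) !c', Nested P R) ↔
      ∃ R ∈ forestPairs (x + 2 * s.numNodes + 2) t !c', Nested P R :=
    exists_congr fun R => nested_rest_iff hP
  by_cases e : ∃ R ∈ forestPairs (x + 2 * s.numNodes + 2) t !c', Nested P R
  · rw [if_pos e, if_pos (hex.2 e)]
  · rw [if_neg e, if_neg fun h => e (hex.1 h)]

theorem contextDepth_inner_ne (b : ℕ) {P : Finset ℕ} (hP : P ∈ forestPairs (x + 1) s !c) :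
    contextDepth (forestPairs x (.node c s t) !c) (forestPairs x (.node c s t) c) b P =
      contextDepth (forestPairs (x + 1) s !c) (forestPairs (x + 1) s c) 0 P := by
  have hset : sameColorChain (forestPairs x (.node c s t) !c) (forestPairs x (.node c s t) c) P =
      sameColorChain (forestPairs (x + 1) s !c) (forestPairs (x + 1) s c) P := by
    ext Q
    constructor
    · rintro ⟨hQ, h, h'⟩
      refine ⟨?_, h, fun R hR hn => h' R (mem_forestPairs_node.2 (.inr (.inl hR))) hn⟩
      rcases h with rfl | h
      · exact hP
      · rcases (nested_inner_iff hP).1 ⟨hQ, h⟩ with h | h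
        · simp at h
        · exact h.1
    · rintro ⟨hQ, h, h'⟩
      refine ⟨mem_forestPairs_node.2 (.inr (.inl hQ)), h, fun R hR hn => ?_⟩
      rcases (nested_inner_iff hP).1 ⟨hR, hn⟩ with ⟨-, rfl⟩ | h
      · exact nested_inner_root hQ
      · exact h' R h.1 h.2
  rw [contextDepth, contextDepth_zero, ← ncard_sameColorChain, hset, ncard_sameColorChain, if_pos,
    add_zero]
  exact ⟨_, (nested_inner_iff hP).2 (.inl ⟨rfl, rfl⟩)⟩

theorem contextDepth_inner_eq (b : ℕ) {P : Finset ℕ} (hP : P ∈ forestPairs (x + 1) s c) :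
    contextDepth (forestPairs x (.node c s t) c) (forestPairs x (.node c s t) !c) b P =
      contextDepth (forestPairs (x + 1) s c) (forestPairs (x + 1) s !c) (b + 1) P := by
  have hiff (R : Finset ℕ) : (R ∈ forestPairs x (.node c s t) !c ∧ Nested P R) ↔
      (R ∈ forestPairs (x + 1) s !c ∧ Nested P R) := by
    rw [nested_inner_iff hP]
    simp
  have hmem (Q : Finset ℕ) :
      Q ∈ sameColorChain (forestPairs x (.node c s t) c) (forestPairs x (.node c s t) !c) P ↔
      Q ∈ sameColorChain (forestPairs (x + 1) s c) (forestPairs (x + 1) s !c) P ∨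
        (Q = {x + 1, x + 2 * s.numNodes + 2} ∧
          ¬ ∃ R ∈ forestPairs (x + 1) s !c, Nested P R) := by
    constructor
    · rintro ⟨hQ, h, h'⟩
      have h'' : ∀ R ∈ forestPairs (x + 1) s !c, Nested P R → Nested Q R := fun R hR hn =>
        h' R ((hiff R).2 ⟨hR, hn⟩).1 hn
      rcases h with rfl | h
      · exact .inl ⟨hP, .inl rfl, h''⟩
      · rcases (nested_inner_iff hP).1 ⟨hQ, h⟩ with ⟨-, rfl⟩ | h
        · refine .inr ⟨rfl, ?_⟩
          rintro ⟨R, hR, hn⟩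
          have := (hiff R).2 ⟨hR, hn⟩
          exact not_nested_root this.1 (h' R this.1 hn)
        · exact .inl ⟨h.1, .inr h.2, h''⟩
    · rintro (⟨hQ, h, h'⟩ | ⟨rfl, h⟩)
      · exact ⟨mem_forestPairs_node.2 (.inr (.inl hQ)), h, fun R hR hn =>
          h' R ((hiff R).1 ⟨hR, hn⟩).1 hn⟩
      · exact ⟨mem_forestPairs_node.2 (.inl ⟨rfl, rfl⟩), .inr (nested_inner_root hP),
          fun R hR hn => absurd ⟨R, (hiff R).1 ⟨hR, hn⟩⟩ h⟩
  rw [contextDepth, contextDepth, ← ncard_sameColorChain, ← ncard_sameColorChain]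
  have hiff' : (∃ R ∈ forestPairs x (.node c s t) !c, Nested P R) ↔
      ∃ R ∈ forestPairs (x + 1) s !c, Nested P R := exists_congr hiff
  by_cases hex : ∃ R ∈ forestPairs (x + 1) s !c, Nested P R
  · rw [if_pos hex, if_pos (hiff'.2 hex)]
    congr 2
    ext Q
    rw [hmem]
    simp [hex]
  · have hset : sameColorChain (forestPairs x (.node c s t) c) (forestPairs x (.node c s t) !c) P =
        insert {x + 1, x + 2 * s.numNodes + 2}
          (sameColorChain (forestPairs (x + 1) s c) (forestPairs (x + 1) s !c) P) := by
      ext Q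
      rw [hmem, Set.mem_insert_iff, or_comm]
      simp only [hex, not_false_eq_true, and_true]
    rw [if_neg hex, if_neg fun h => hex (hiff'.1 h), hset,
      Set.ncard_insert_of_notMem _ (finite_sameColorChain _ _ _)]
    · omega
    · intro h
      have := (forestPairs_inner_bounds h.1 (i := x + 1) (by simp)).1
      omega

end Node

theorem depthBounded_iff (K L : ℕ) (t : BinaryTree Bool) : ∀ (x b r : ℕ),
    DepthBounded K L b r t ↔ ∀ c, ∀ P ∈ forestPairs x t c,
      contextDepth (forestPairs x t c) (forestPairs x t !c) (cond c b r) P ≤ cond c K L := by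
  induction t with
  | nil => simp [DepthBounded, forestPairs]
  | node c s t hs ht =>
    intro x b r
    have hnode : (∀ c', ∀ P ∈ forestPairs x (.node c s t) c',
        contextDepth (forestPairs x (.node c s t) c') (forestPairs x (.node c s t) !c')
          (cond c' b r) P ≤ cond c' K L) ↔
        cond c b r < cond c K L ∧
        (∀ c', ∀ P ∈ forestPairs (x + 1) s c',
          contextDepth (forestPairs (x + 1) s c') (forestPairs (x + 1) s !c')
            (if c' = c then cond c b r + 1 else 0) P ≤ cond c' K L) ∧
        (∀ c', ∀ P ∈ forestPairs (x + 2 * s.numNodes + 2) t c',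
          contextDepth (forestPairs (x + 2 * s.numNodes + 2) t c')
            (forestPairs (x + 2 * s.numNodes + 2) t !c') (cond c' b r) P ≤ cond c' K L) := by
      have hin (c' : Bool) (P : Finset ℕ) (hP : P ∈ forestPairs (x + 1) s c') :
          contextDepth (forestPairs x (.node c s t) c') (forestPairs x (.node c s t) !c')
            (cond c' b r) P =
          contextDepth (forestPairs (x + 1) s c') (forestPairs (x + 1) s !c')
            (if c' = c then cond c b r + 1 else 0) P := by
        by_cases h : c' = c
        · subst h
          rw [if_pos rfl]
          exact contextDepth_inner_eq _ hP
        · have h' : c' = !c := by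
            revert h
            cases c <;> cases c' <;> simp
          subst h'
          rw [if_neg h, Bool.not_not]
          exact contextDepth_inner_ne _ hP
      constructor
      · intro h
        refine ⟨?_, fun c' P hP => ?_, fun c' P hP => ?_⟩
        · have := h c _ (mem_forestPairs_node.2 (.inl ⟨rfl, rfl⟩))
          rw [contextDepth_root] at this
          exact this
        · rw [← hin c' P hP]
          exact h c' P (mem_forestPairs_node.2 (.inr (.inl hP)))
        · rw [← contextDepth_rest (c := c) _ hP]
          exact h c' P (mem_forestPairs_node.2 (.inr (.inr hP)))
      · rintro ⟨h1, h2, h3⟩ c' P hP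
        rcases mem_forestPairs_node.1 hP with ⟨rfl, rfl⟩ | hP | hP
        · rw [contextDepth_root]
          exact h1
        · rw [hin c' P hP]
          exact h2 c' P hP
        · rw [contextDepth_rest _ hP]
          exact h3 c' P hP
    rw [hnode]
    cases c <;> simp only [DepthBounded, hs (x + 1), ht (x + 2 * s.numNodes + 2)] <;> simp

theorem ncard_isColoredNC (K L p : ℕ) :
    {c : Finset (Finset ℕ) × Finset (Finset ℕ) | IsColoredNC 0 p (fun i => cond i c.1 c.2) ∧
      (∀ P ∈ c.1, relDepth c.1 c.2 P ≤ K) ∧ (∀ P ∈ c.2, relDepth c.2 c.1 P ≤ L)}.ncard =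
      if 2 ∣ p then (boundedForests K L 0 0 (p / 2)).card else 0 := by
  split_ifs with hp
  · obtain ⟨n, rfl⟩ := hp
    rw [Nat.mul_div_cancel_left n two_pos, ← Set.ncard_coe_finset]
    have hinj : Function.Injective fun t : BinaryTree Bool =>
        (forestPairs 0 t true, forestPairs 0 t false) := by
      intro t t' h
      refine forestPairs_injective t 0 t' ?_
      funext c
      rw [Prod.mk.injEq] at h
      cases c
      · exact h.2
      · exact h.1
    rw [← Set.ncard_image_of_injective _ hinj]
    congr 1
    ext ⟨B, R⟩
    simp only [Set.mem_ofPred_eq, Set.mem_image, Finset.mem_coe, mem_boundedForests,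
      Prod.mk.injEq, depthBounded_iff K L _ 0 0 0, Bool.cond_self, contextDepth_zero,
      Bool.forall_bool, cond_true, cond_false, Bool.not_true, Bool.not_false]
    constructor
    · rintro ⟨h, hB, hR⟩
      obtain ⟨t, ht, hf⟩ := exists_forestPairs_eq (2 * n) _ _ _ h (zero_add _).symm
      have e1 : B = forestPairs 0 t true := congrFun hf true
      have e2 : R = forestPairs 0 t false := congrFun hf false
      subst e1 e2
      exact ⟨t, ⟨by omega, hR, hB⟩, rfl, rfl⟩
    · rintro ⟨t, ⟨rfl, hR, hB⟩, rfl, rfl⟩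
      refine ⟨?_, hB, hR⟩
      have h := isColoredNC_forestPairs t 0
      rw [zero_add] at h
      convert h using 1
      funext c
      cases c <;> rfl
  · convert Set.ncard_empty (Finset (Finset ℕ) × Finset (Finset ℕ))
    rw [Set.eq_empty_iff_forall_notMem]
    rintro c ⟨h, -⟩
    obtain ⟨t, ht, -⟩ := exists_forestPairs_eq p _ _ _ h (zero_add _).symm
    exact hp ⟨t.numNodes, by omega⟩

theorem isColoredNC_iff (p : ℕ) (B R : Finset (Finset ℕ)) :
    IsColoredNC 0 p (fun i => cond i B R) ↔
      Disjoint B R ∧ IsPairPartition p (B ∪ R) ∧ NonCrossing (B ∪ R) := by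
  have hmem {P : Finset ℕ} : P ∈ B ∪ R ↔ ∃ c : Bool, P ∈ cond c B R := by
    simp [or_comm]
  constructor
  · intro h
    refine ⟨?_, ⟨?_, ?_, ?_⟩, ?_⟩
    · rw [Finset.disjoint_left]
      intro P hB hR
      obtain ⟨i, hi⟩ := h.nonempty (c := true) hB
      simpa using (h.unique true false P P i hB hR hi hi).1
    · intro P hP
      obtain ⟨c, hc⟩ := hmem.1 hP
      exact h.card_eq c P hc
    · intro i
      rw [Finset.mem_Icc, Nat.succ_le_iff, ← h.cover i]
      constructor
      · rintro ⟨P, hP, hi⟩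
        obtain ⟨c, hc⟩ := hmem.1 hP
        exact ⟨c, P, hc, hi⟩
      · rintro ⟨c, P, hc, hi⟩
        exact ⟨P, hmem.2 ⟨c, hc⟩, hi⟩
    · intro P hP Q hQ hne
      obtain ⟨c, hc⟩ := hmem.1 hP
      obtain ⟨c', hc'⟩ := hmem.1 hQ
      rw [Finset.disjoint_left]
      intro i hi hi'
      exact hne (h.unique c c' P Q i hc hc' hi hi').2
    · rintro P hP Q hQ - ⟨i, hi, j, hj, k, hk, l, hl, h1, h2, h3⟩
      obtain ⟨c, hc⟩ := hmem.1 hP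
      obtain ⟨c', hc'⟩ := hmem.1 hQ
      exact h.noncrossing c c' P Q hc hc' i hi j hj k hk l hl h1 h2 h3
  · rintro ⟨hd, ⟨hcard, hcov, hdisj⟩, hnc⟩
    refine ⟨fun c P hP => hcard P (hmem.2 ⟨c, hP⟩), fun i => ?_, ?_, ?_⟩
    · rw [← Nat.succ_le_iff, ← Finset.mem_Icc, ← hcov i]
      constructor
      · rintro ⟨c, P, hc, hi⟩
        exact ⟨P, hmem.2 ⟨c, hc⟩, hi⟩
      · rintro ⟨P, hP, hi⟩
        obtain ⟨c, hc⟩ := hmem.1 hP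
        exact ⟨c, P, hc, hi⟩
    · intro c c' P Q i hP hQ hiP hiQ
      have hPQ : P = Q := by
        by_contra hne
        exact Finset.disjoint_left.1 (hdisj P (hmem.2 ⟨c, hP⟩) Q (hmem.2 ⟨c', hQ⟩) hne) hiP hiQ
      subst hPQ
      refine ⟨?_, rfl⟩
      have hP' : P ∈ B → P ∉ R := fun h => Finset.disjoint_left.1 hd h
      cases c <;> cases c' <;> simp_all
    · intro c c' P Q hP hQ i hi j hj k hk l hl h1 h2 h3
      by_cases hPQ : P = Q
      · subst hPQ
        have hsub : ({i, j, k} : Finset ℕ) ⊆ P := by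
          intro m hm
          simp only [Finset.mem_insert, Finset.mem_singleton] at hm
          rcases hm with rfl | rfl | rfl <;> assumption
        have h3 : ({i, j, k} : Finset ℕ).card = 3 :=
          Finset.card_eq_three.2 ⟨i, j, k, by omega, by omega, by omega, rfl⟩
        have := Finset.card_le_card hsub
        have := hcard P (hmem.2 ⟨c, hP⟩)
        omega
      · exact hnc P (hmem.2 ⟨c, hP⟩) Q (hmem.2 ⟨c', hQ⟩) hPQ
          ⟨i, hi, j, hj, k, hk, l, hl, h1, h2, h3⟩

theorem Anum_eq (k n : ℕ) : Anum k n = (boundedForests (k - 1) (k - 1) 0 0 n).card := by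
  have h := ncard_isColoredNC (k - 1) (k - 1) (2 * n)
  rw [if_pos (dvd_mul_right 2 n), Nat.mul_div_cancel_left n two_pos] at h
  rw [← h, Anum]
  congr 1
  ext c
  simp only [Set.mem_ofPred_eq, isColoredNC_iff, MemTCNC2, and_assoc]

theorem relDepth_empty (π : Finset (Finset ℕ)) (P : Finset ℕ) :
    relDepth π ∅ P = pairDepth π P := by
  simp [relDepth, pairDepth]

theorem relDepth_pos {S : Finset (Finset ℕ)} (O : Finset (Finset ℕ)) {P : Finset ℕ} (hP : P ∈ S) :
    0 < relDepth S O P :=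
  (Set.ncard_pos (finite_sameColorChain S O P)).2 ⟨P, hP, .inl rfl, fun _ _ h => h⟩

theorem cnum_eq (l p : ℕ) :
    cnum l p = if 2 ∣ p then (boundedForests (l - 1) 0 0 0 (p / 2)).card else 0 := by
  have hinj : Function.Injective fun π : Finset (Finset ℕ) => (π, (∅ : Finset (Finset ℕ))) :=
    fun _ _ h => (Prod.mk.inj h).1
  rw [← ncard_isColoredNC, cnum, ← Set.ncard_image_of_injective _ hinj]
  congr 1
  ext ⟨B, R⟩
  simp only [Set.mem_ofPred_eq, Set.mem_image, isColoredNC_iff, Prod.mk.injEq]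
  constructor
  · rintro ⟨π, ⟨h1, h2, h3⟩, rfl, rfl⟩
    simpa [relDepth_empty] using ⟨⟨h1, h2⟩, h3⟩
  · rintro ⟨⟨-, h1, h2⟩, h3, h4⟩
    have hR : R = ∅ := by
      rw [Finset.eq_empty_iff_forall_notMem]
      intro P hP
      exact absurd (h4 P hP) (relDepth_pos B hP).not_ge
    subst hR
    rw [Finset.union_empty] at h1 h2
    exact ⟨B, ⟨h1, h2, fun P hP => relDepth_empty B P ▸ h3 P hP⟩, rfl, rfl⟩

open PowerSeries in
theorem coeff_depthSeries (l p : ℕ) : coeff p (depthSeries l) = (cnum l p : ℚ) := by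
  rw [depthSeries, coeff_expand, cnum_eq]
  split_ifs <;> simp [forestSeries]

open PowerSeries in
theorem Dnum_eq_coeff (l p q : ℕ) : (Dnum l p q : ℚ) = coeff p ((X * depthSeries l) ^ q) := by
  classical
  have hodd (m : ℕ) : coeff m (X * depthSeries l) = if Odd m then (cnum l (m - 1) : ℚ) else 0 := by
    cases m with
    | zero => simp
    | succ m =>
      rw [coeff_succ_X_mul, coeff_depthSeries]
      split_ifs with h
      · simp
      · rw [← coeff_depthSeries, depthSeries, coeff_expand, if_neg]
        rw [Nat.not_odd_iff_even, Nat.even_add_one, Nat.not_even_iff_odd] at h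
        rwa [← even_iff_two_dvd, Nat.not_even_iff_odd]
  have hprod : (X * depthSeries l) ^ q = ∏ _i : Fin q, (X * depthSeries l) := by simp
  rw [hprod, coeff_prod, Dnum]
  push_cast
  simp only [hodd]
  rw [← Finset.sum_filter_add_sum_filter_not (Finset.finsuppAntidiag _ p)
    (fun f : Fin q →₀ ℕ => ∀ i, Odd (f i))]
  rw [Finset.sum_eq_zero (s := Finset.filter (fun f : Fin q →₀ ℕ => ¬ ∀ i, Odd (f i)) _), add_zero]
  · refine Finset.sum_bij' (fun f _ => Finsupp.equivFunOnFinite.symm fun i => (f i : ℕ))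
      (fun f _ i => Fin.ofNat (p + 1) (f i)) ?_ ?_ ?_ ?_ ?_
    · intro f hf
      simp only [Finset.mem_filter, Finset.mem_univ, true_and] at hf
      simp [Finset.mem_finsuppAntidiag, hf.1, hf.2]
    · intro f hf
      simp only [Finset.mem_filter, Finset.mem_finsuppAntidiag, Finset.subset_univ, and_true] at hf
      have hle (i : Fin q) : f i < p + 1 := by
        rw [Nat.lt_succ_iff, ← hf.1]
        exact Finset.single_le_sum (f := f) (fun _ _ => Nat.zero_le _) (Finset.mem_univ i)
      simp [Nat.mod_eq_of_lt (hle _), hf.1, hf.2]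
    · intro f hf
      ext i
      simp
    · intro f hf
      simp only [Finset.mem_filter, Finset.mem_finsuppAntidiag, Finset.subset_univ, and_true] at hf
      have hle (i : Fin q) : f i < p + 1 := by
        rw [Nat.lt_succ_iff, ← hf.1]
        exact Finset.single_le_sum (f := f) (fun _ _ => Nat.zero_le _) (Finset.mem_univ i)
      ext i
      simp [Nat.mod_eq_of_lt (hle _)]
    · intro f hf
      simp only [Finset.mem_filter, Finset.mem_univ, true_and] at hf
      simp [hf.1]
  · intro f hf
    simp only [Finset.mem_filter, not_forall] at hf
    obtain ⟨i, hi⟩ := hf.2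
    exact Finset.prod_eq_zero (Finset.mem_univ i) (by simp [hi])

open PowerSeries in
theorem Dnum_eq_coeff_add (l p q : ℕ) :
    (Dnum l p q : ℚ) = coeff (p + q) ((X ^ 2 * depthSeries l) ^ q) := by
  have : (X ^ 2 * depthSeries l) ^ q = (X * depthSeries l) ^ q * X ^ q := by ring
  rw [this, coeff_mul_X_pow, Dnum_eq_coeff]

open PowerSeries in
theorem Dnum_eq_zero (l p q : ℕ) (h : p < q) : Dnum l p q = 0 := by
  have := Dnum_eq_coeff l p q
  rw [mul_pow, coeff_X_pow_mul', if_neg (by omega)] at this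
  exact_mod_cast this

theorem sum_Icc_eq_sum_range (f : ℕ → ℚ) (a b : ℕ) (hf : ∀ i < a, f i = 0) :
    ∑ i ∈ Finset.Icc a b, f i = ∑ i ∈ Finset.range (b + 1), f i := by
  refine Finset.sum_subset (fun i hi => ?_) fun i hi hi' => hf i ?_
  · simp only [Finset.mem_Icc, Finset.mem_range] at *
    omega
  · simp only [Finset.mem_Icc, Finset.mem_range] at *
    omega

open PowerSeries in
theorem sum_choose_Dnum (l m a : ℕ) (hm : 1 ≤ m) (ha : a ≤ m) :
    ∑ i ∈ Finset.Icc a (2 * m - 1), (Nat.choose (2 * m - 1) i : ℚ) * (Dnum l i (2 * m - i) : ℚ) =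
      coeff (2 * m) (X ^ 2 * depthSeries l * (1 + X ^ 2 * depthSeries l) ^ (2 * m - 1)) := by
  rw [sum_Icc_eq_sum_range, add_pow, Finset.mul_sum, map_sum]
  · refine Finset.sum_congr rfl fun i hi => ?_
    rw [Finset.mem_range] at hi
    rw [Dnum_eq_coeff_add]
    have e1 : i + (2 * m - i) = 2 * m := by omega
    have e2 : 2 * m - i = 2 * m - 1 - i + 1 := by omega
    rw [e1, e2, one_pow, one_mul, ← mul_assoc, ← pow_succ',
      ← map_natCast (C (R := ℚ)), coeff_mul_C, mul_comm]
  · intro i hi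
    rw [Dnum_eq_zero _ _ _ (by omega)]
    simp

open PowerSeries in
theorem sum_choose_Dnum_succ (l m : ℕ) (hm : 1 ≤ m) :
    ∑ p ∈ Finset.Icc (m - 1) (2 * m - 1),
        (Nat.choose (2 * m - 1) p : ℚ) * (Dnum l (p + 1) (2 * m - p - 1) : ℚ) =
      coeff (2 * m) ((1 + X ^ 2 * depthSeries l) ^ (2 * m - 1)) := by
  rw [sum_Icc_eq_sum_range, add_pow, map_sum]
  · refine Finset.sum_congr rfl fun i hi => ?_
    rw [Finset.mem_range] at hi
    rw [Dnum_eq_coeff_add]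
    have e1 : i + 1 + (2 * m - i - 1) = 2 * m := by omega
    have e2 : 2 * m - i - 1 = 2 * m - 1 - i := by omega
    rw [e1, e2, one_pow, one_mul,
      ← map_natCast (C (R := ℚ)), coeff_mul_C, mul_comm]
  · intro i hi
    rw [Dnum_eq_zero _ _ _ (by omega)]
    simp

open PowerSeries in
/-- A coefficient of `φ ^ N * a(z)` with `z = (X / φ)²`, expanded in powers of `z`. -/
theorem coeff_mul_subst (n : ℕ) (φ ψ z A : PowerSeries ℚ) (hz : z * φ ^ 2 = X ^ 2)
    (hφ : constantCoeff φ = 1) (hzX : X ^ 2 ∣ z) (hn : 1 ≤ n) :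
    coeff (2 * n) (φ ^ (2 * n - 1) * ψ * A.subst z) =
      coeff n A * constantCoeff ψ + ∑ j ∈ Finset.range n, coeff j A *
        coeff (2 * (n - j)) (φ ^ (2 * (n - j) - 1) * ψ) := by
  have hs : HasSubst z := HasSubst.of_constantCoeff_zero'
    (X_dvd_iff.1 ((dvd_pow_self X two_ne_zero).trans hzX))
  have hsubst : ∃ R, A.subst z = ∑ j ∈ Finset.range (n + 1), C (coeff j A) * z ^ j
      + z ^ (n + 1) * R := by
    obtain ⟨R, hR⟩ : X ^ (n + 1) ∣ A - (trunc (n + 1) A : PowerSeries ℚ) := by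
      rw [X_pow_dvd_iff]
      intro m hm
      simp [coeff_trunc, hm]
    have h := congrArg (substAlgHom hs) (sub_eq_iff_eq_add.1 hR)
    refine ⟨R.subst z, ?_⟩
    rw [map_add, map_mul, map_pow, substAlgHom_X, substAlgHom_coe, coe_substAlgHom] at h
    rw [h, add_comm]
    congr 1
    rw [Polynomial.aeval_eq_sum_range' (natDegree_trunc_lt A n)]
    refine Finset.sum_congr rfl fun j hj => ?_
    rw [coeff_trunc, if_pos (Finset.mem_range.1 hj), smul_eq_C_mul]
  obtain ⟨R, hR⟩ := hsubst
  have hφ0 : φ ≠ 0 := by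
    rintro rfl
    simp at hφ
  rw [hR, mul_add, map_add, Finset.sum_range_succ, mul_add, Finset.mul_sum, map_add, map_sum]
  have hzero : coeff (2 * n) (φ ^ (2 * n - 1) * ψ * (z ^ (n + 1) * R)) = 0 := by
    have h : X ^ (2 * n + 2) ∣ φ ^ (2 * n - 1) * ψ * (z ^ (n + 1) * R) := by
      have : (X : PowerSeries ℚ) ^ (2 * n + 2) = (X ^ 2) ^ (n + 1) := by ring
      rw [this]
      exact Dvd.dvd.mul_left ((pow_dvd_pow_of_dvd hzX _).mul_right _) _
    exact X_pow_dvd_iff.1 h _ (by omega)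
  have hpow (j : ℕ) : z ^ j * φ ^ (2 * j) = X ^ (2 * j) := by
    rw [pow_mul, pow_mul, ← mul_pow, hz]
  have htop : coeff (2 * n) (φ ^ (2 * n - 1) * ψ * (C (coeff n A) * z ^ n)) =
      coeff n A * constantCoeff ψ := by
    obtain ⟨y, hy⟩ : ∃ y, z ^ n = X ^ (2 * n) * y := by
      obtain ⟨y, rfl⟩ := hzX
      exact ⟨y ^ n, by ring⟩
    have h1 : y * φ ^ (2 * n) = 1 := by
      have := hpow n
      rw [hy, mul_assoc] at this
      exact mul_left_cancel₀ (pow_ne_zero (2 * n) X_ne_zero) (this.trans (mul_one _).symm)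
    have h2 : constantCoeff y = 1 := by
      have := congrArg constantCoeff h1
      simpa [hφ] using this
    have : φ ^ (2 * n - 1) * ψ * (C (coeff n A) * z ^ n) =
        C (coeff n A) * (X ^ (2 * n) * (φ ^ (2 * n - 1) * ψ * y)) := by
      rw [hy]
      ring
    rw [this, coeff_C_mul, coeff_X_pow_mul', if_pos le_rfl, Nat.sub_self]
    simp [hφ, h2]
  rw [hzero, htop, add_zero, add_comm]
  congr 1
  refine Finset.sum_congr rfl fun j hj => ?_
  rw [Finset.mem_range] at hj
  have e1 : 2 * n - 1 = 2 * (n - j) - 1 + 2 * j := by omega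
  have : φ ^ (2 * n - 1) * ψ * (C (coeff j A) * z ^ j) =
      C (coeff j A) * (X ^ (2 * j) * (φ ^ (2 * (n - j) - 1) * ψ)) := by
    rw [e1, ← hpow j]
    ring
  have e2 : 2 * n - 2 * j = 2 * (n - j) := by omega
  rw [this, coeff_C_mul, coeff_X_pow_mul', if_pos (by omega), e2]

open PowerSeries in
theorem Anum_recursion (k : ℕ) (hk : 2 ≤ k) (n : ℕ) (hn : 1 ≤ n) :
    (Anum k n : ℚ) =
      2 * ∑ i ∈ Finset.Icc n (2 * n - 1),
          (Nat.choose (2 * n - 1) i : ℚ) * (Dnum (k - 1) i (2 * n - i) : ℚ)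
      - ∑ j ∈ Finset.Icc 1 (n - 2), (Anum k j : ℚ) *
          ∑ p ∈ Finset.Icc (n - j - 1) (2 * (n - j) - 1),
            (Nat.choose (2 * (n - j) - 1) p : ℚ) *
              ((Dnum (k - 1) (p + 1) (2 * (n - j) - p - 1) : ℚ) -
                (Dnum (k - 1) p (2 * (n - j) - p) : ℚ)) := by
  set K := k - 1 with hKdef
  set φ : PowerSeries ℚ := 1 + X ^ 2 * depthSeries K with hφ
  set A := forestSeries K K 0 0 with hA
  have hAc (j : ℕ) : coeff j A = (Anum k j : ℚ) := by
    rw [hA, forestSeries, coeff_mk, Anum_eq]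
  have hφ1 : constantCoeff φ = 1 := by simp [hφ]
  set z : PowerSeries ℚ := X ^ 2 * (φ⁻¹) ^ 2 with hz
  have hzφ : z * φ ^ 2 = X ^ 2 := by
    rw [hz, mul_assoc, ← mul_pow, PowerSeries.inv_mul_cancel _ (by simp [hφ1]), one_pow, mul_one]
  have hzX : X ^ 2 ∣ z := Dvd.intro _ rfl
  have hsub := subst_forestSeries K (by omega) φ z hφ hzφ
    ((dvd_pow_self X two_ne_zero).trans hzX)
  have hinner (m : ℕ) (hm : 1 ≤ m) : ∑ p ∈ Finset.Icc (m - 1) (2 * m - 1),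
          (Nat.choose (2 * m - 1) p : ℚ) *
            ((Dnum K (p + 1) (2 * m - p - 1) : ℚ) - (Dnum K p (2 * m - p) : ℚ)) =
      coeff (2 * m) (φ ^ (2 * m - 1) * (2 - φ)) := by
    simp only [mul_sub, Finset.sum_sub_distrib]
    rw [sum_choose_Dnum_succ K m hm, sum_choose_Dnum K m _ hm (by omega), ← map_sub]
    congr 1
    rw [← hφ, hφ]
    ring
  have hmain := coeff_mul_subst n φ (2 - φ) z A hzφ hφ1 hzX hn
  rw [mul_assoc, hsub] at hmain
  rw [sum_choose_Dnum K n n hn le_rfl, ← hφ]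
  have hlast : coeff (2 * 1) (φ ^ (2 * 1 - 1) * (2 - φ)) = 0 := by
    have : φ ^ (2 * 1 - 1) * (2 - φ) = 1 - X ^ 4 * depthSeries K ^ 2 := by
      rw [hφ]
      ring
    rw [this, map_sub, coeff_X_pow_mul', if_neg (by omega)]
    simp [coeff_one]
  have hsum : ∑ j ∈ Finset.range n, coeff j A *
      coeff (2 * (n - j)) (φ ^ (2 * (n - j) - 1) * (2 - φ)) =
      coeff (2 * n) (φ ^ (2 * n - 1) * (2 - φ)) +
      ∑ j ∈ Finset.Icc 1 (n - 2), coeff j A *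
      coeff (2 * (n - j)) (φ ^ (2 * (n - j) - 1) * (2 - φ)) := by
    have hA0 : coeff 0 A = 1 := by
      rw [hA, forestSeries, coeff_mk, card_boundedForests_zero, Nat.cast_one]
    obtain ⟨m, rfl⟩ : ∃ m, n = m + 1 := ⟨n - 1, by omega⟩
    rw [Finset.sum_range_succ', hA0, add_comm, one_mul, Nat.sub_zero]
    congr 1
    cases m with
    | zero => simp
    | succ m =>
      have e : m + 1 + 1 - (m + 1) = 1 := by omega
      rw [Finset.sum_range_succ, e, hlast, mul_zero, add_zero, ← Finset.Ico_add_one_right_eq_Icc,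
        Finset.sum_Ico_eq_sum_range]
      refine Finset.sum_congr (by congr 1) fun j _ => ?_
      rw [add_comm 1 j]
  have hpow : φ ^ (2 * n - 1) * φ =
      φ ^ (2 * n - 1) * (2 - φ) + C 2 * (X ^ 2 * depthSeries K * φ ^ (2 * n - 1)) := by
    have : (C 2 : PowerSeries ℚ) = 2 := map_ofNat C 2
    rw [this]
    nth_rewrite 2 [hφ]
    nth_rewrite 3 [hφ]
    ring
  rw [hsum, hpow, map_add, coeff_C_mul, hAc] at hmain
  have hconst : constantCoeff (2 - φ) = 1 := by
    rw [map_sub, hφ1, map_ofNat]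
    norm_num
  rw [hconst] at hmain
  have hsum2 : ∑ j ∈ Finset.Icc 1 (n - 2), (Anum k j : ℚ) *
        ∑ p ∈ Finset.Icc (n - j - 1) (2 * (n - j) - 1),
          (Nat.choose (2 * (n - j) - 1) p : ℚ) *
            ((Dnum K (p + 1) (2 * (n - j) - p - 1) : ℚ) -
              (Dnum K p (2 * (n - j) - p) : ℚ)) =
      ∑ j ∈ Finset.Icc 1 (n - 2), coeff j A *
      coeff (2 * (n - j)) (φ ^ (2 * (n - j) - 1) * (2 - φ)) := by
    refine Finset.sum_congr rfl fun j hj => ?_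
    rw [Finset.mem_Icc] at hj
    rw [hinner (n - j) (by omega), hAc]
  rw [hsum2]
  linarith

theorem stmt13 (k : ℕ) (hk : 2 ≤ k) (n : ℕ) (hn : 1 ≤ n) :
    (Anum k n : ℤ) =
      2 * ∑ i ∈ Finset.Icc n (2 * n - 1),
          (Nat.choose (2 * n - 1) i : ℤ) * (Dnum (k - 1) i (2 * n - i) : ℤ)
      - ∑ j ∈ Finset.Icc 1 (n - 2), (Anum k j : ℤ) *
          ∑ p ∈ Finset.Icc (n - j - 1) (2 * (n - j) - 1),
            (Nat.choose (2 * (n - j) - 1) p : ℤ) *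
              ((Dnum (k - 1) (p + 1) (2 * (n - j) - p - 1) : ℤ) -
                (Dnum (k - 1) p (2 * (n - j) - p) : ℤ)) := by
  exact_mod_cast Anum_recursion k hk n hn
end
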